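/- arXiv:1003.1659 — 5 statements merged into one kernel-verified Lean document; each statement's English description precedes it below -/
import Mathlib

section
/- Let k be a finite field of characteristic p and cardinality q, let n and d be natural numbers with 1 ≤ d and d ≤ n, and let f be a homogeneous polynomial of degree d in n+1 variables with coefficients in k. Then the number of points of the projective hypersurface H = {f = 0} in P^n(k) — that is, the number of equivalence classes, under scalar multiplication by k^*, of nonzero vectors x ∈ k^{n+1} with f(x) = 0 — is congruent to 1 modulo p. In particular H(k) is nonempty. -/
open scoped LinearAlgebra.Projectivization

/-- The nonzero vectors of a cone `S` are counted by its lines, each contributing `#kˣ` vectors. -/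
theorem Projectivization.card_nonzero_mem_cone {k V : Type*} [Field k] [AddCommGroup V] [Module k V]
    (S : Set V) (hS : ∀ (a : kˣ) (v : V), v ∈ S → a • v ∈ S) :
    Nat.card {v : V // v ≠ 0 ∧ v ∈ S} =
      Nat.card {P : ℙ k V // ∃ (v : V) (hv : v ≠ 0), P = mk k v hv ∧ v ∈ S} * Nat.card kˣ := by
  have rep_mem {P : ℙ k V} (hP : ∃ (v : V) (hv : v ≠ 0), P = mk k v hv ∧ v ∈ S) : P.rep ∈ S := by
    obtain ⟨v, hv, rfl, hvS⟩ := hP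
    obtain ⟨a, ha⟩ := exists_smul_eq_mk_rep k v hv
    exact ha ▸ hS a v hvS
  rw [← Nat.card_prod]
  symm
  refine Nat.card_eq_of_bijective (fun x ↦ ⟨x.2 • x.1.1.rep,
    (smul_ne_zero_iff_ne x.2).2 x.1.1.rep_nonzero, hS _ _ (rep_mem x.1.2)⟩) ⟨?_, ?_⟩
  · rintro ⟨⟨P, hP⟩, a⟩ ⟨⟨Q, hQ⟩, b⟩ h
    have h : a • P.rep = b • Q.rep := congrArg Subtype.val h
    obtain rfl : P = Q := by
      rw [← P.mk_rep, ← Q.mk_rep, mk_eq_mk_iff]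
      exact ⟨a⁻¹ * b, by rw [mul_smul, ← h, inv_smul_smul]⟩
    have hab : (a : k) = b := smul_left_injective k P.rep_nonzero h
    rw [Units.ext hab]
  · rintro ⟨v, hv, hvS⟩
    obtain ⟨a, ha⟩ := exists_smul_eq_mk_rep k v hv
    refine ⟨⟨⟨mk k v hv, v, hv, rfl, hvS⟩, a⁻¹⟩, Subtype.ext ?_⟩
    simp only [← ha, inv_smul_smul]

/-- The zero locus of a homogeneous polynomial is stable under scaling. -/
theorem MvPolynomial.IsHomogeneous.eval_smul_eq_zero {σ k : Type*} [CommSemiring k]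
    {f : MvPolynomial σ k} {d : ℕ} (hf : f.IsHomogeneous d) (a : k) {v : σ → k}
    (hv : eval v f = 0) : eval (a • v) f = 0 := by
  have h : eval (a • v) f = a ^ d * eval v f := by
    simp only [eval_eq, Finset.mul_sum]
    refine Finset.sum_congr rfl fun m hm ↦ ?_
    have hd : ∑ i ∈ m.support, m i = d := by
      rw [← hf (mem_support_iff.1 hm), Finsupp.weight_apply]
      simp [Finsupp.sum]
    simp only [Pi.smul_apply, smul_eq_mul, mul_pow, Finset.prod_mul_distrib,
      Finset.prod_pow_eq_pow_sum, hd]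
    ring
  rw [h, hv, mul_zero]

/-- **Chevalley–Warning theorem** (projective form). Over a finite field `k` of
characteristic `p`, a projective hypersurface of degree `d ≤ n` in `ℙⁿ` has a number of
`k`-points congruent to `1` modulo `p`; in particular it has a `k`-point. The `k`-points
are the classes, modulo scalar multiplication, of nonzero vectors `v ∈ k^{n+1}` with
`f v = 0`. -/
theorem chevalley_warning_projective
    (p q : ℕ) (hp : p.Prime) (k : Type) [Field k] [Fintype k] [CharP k p]
    (hq : Fintype.card k = q)
    (n d : ℕ) (hd : 1 ≤ d) (hdn : d ≤ n)
    (f : MvPolynomial (Fin (n + 1)) k) (hf : f.IsHomogeneous d) :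
    Nat.card {P : Projectivization k (Fin (n + 1) → k) //
        ∃ (v : Fin (n + 1) → k) (hv : v ≠ 0),
          P = Projectivization.mk k v hv ∧ MvPolynomial.eval v f = 0} ≡ 1 [MOD p] ∧
    Nonempty {P : Projectivization k (Fin (n + 1) → k) //
        ∃ (v : Fin (n + 1) → k) (hv : v ≠ 0),
          P = Projectivization.mk k v hv ∧ MvPolynomial.eval v f = 0} := by
  classical
  have hmod : Nat.card {P : Projectivization k (Fin (n + 1) → k) //
      ∃ (v : Fin (n + 1) → k) (hv : v ≠ 0),
        P = Projectivization.mk k v hv ∧ MvPolynomial.eval v f = 0} ≡ 1 [MOD p] := by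
    have hcone := Projectivization.card_nonzero_mem_cone (k := k)
      {v : Fin (n + 1) → k | MvPolynomial.eval v f = 0}
      fun a v hv ↦ hf.eval_smul_eq_zero (a : k) hv
    simp only [Set.mem_ofPred_eq] at hcone
    have hdvd : p ∣ Fintype.card {v : Fin (n + 1) → k // MvPolynomial.eval v f = 0} :=
      char_dvd_card_solutions p <| by
        simpa using hf.totalDegree_le.trans_lt (Nat.lt_succ_of_le hdn)
    have hzero : MvPolynomial.eval (0 : Fin (n + 1) → k) f = 0 := by
      rw [MvPolynomial.eval_zero, MvPolynomial.constantCoeff_eq]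
      exact hf.coeff_eq_zero (by simp; lia)
    have hsplit : Nat.card {v : Fin (n + 1) → k // v ≠ 0 ∧ MvPolynomial.eval v f = 0} + 1 =
        Fintype.card {v : Fin (n + 1) → k // MvPolynomial.eval v f = 0} := by
      rw [Nat.card_eq_fintype_card, Fintype.card_subtype, Fintype.card_subtype,
        ← Finset.card_erase_add_one (a := 0) (s := {v | MvPolynomial.eval v f = 0})
          (by simpa using hzero)]
      congr 2
      ext v
      simp
    have hunits : (Nat.card kˣ : ZMod p) = -1 := by
      have hqp : (Fintype.card k : ZMod p) = 0 :=
        (ZMod.natCast_eq_zero_iff _ _).2 <|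
          (CharP.cast_eq_zero_iff k p _).1 (Nat.cast_card_eq_zero k)
      rw [Nat.card_eq_fintype_card, Fintype.card_units, Nat.cast_sub Fintype.card_pos, hqp]
      simp
    rw [← hsplit, hcone, ← ZMod.natCast_eq_zero_iff] at hdvd
    push_cast at hdvd
    rw [hunits] at hdvd
    rw [← ZMod.natCast_eq_natCast_iff]
    push_cast
    linear_combination -hdvd
  refine ⟨hmod, not_isEmpty_iff.1 fun h ↦ ?_⟩
  rw [Nat.card_of_isEmpty] at hmod
  exact hp.one_lt.ne' (Nat.dvd_one.1 ((Nat.modEq_iff_dvd' zero_le_one).1 hmod))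
end

section
/- Let k be a finite field of cardinality q, let n and d be natural numbers with 1 ≤ d and d ≤ n, and let f be a homogeneous polynomial of degree d in n+1 variables with coefficients in k. Then the number of points of the projective hypersurface H = {f = 0} in P^n(k) — that is, the number of equivalence classes, under scalar multiplication by k^*, of nonzero vectors x ∈ k^{n+1} with f(x) = 0 — is congruent to 1 modulo q. -/
open Finset

/-- For every natural number `e` there is an `r`-periodic family `g` of natural numbers, obtained by
cyclically shifting the base `p` digits of `e` over `r` positions, with `g j` congruent to
`p ^ j * e` modulo `p ^ r - 1`. -/
theorem exists_cyclic_digit_shifts {p : ℕ} (hp : 1 < p) (r e : ℕ) :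
    ∃ g : ℕ → ℕ, (∀ j, g (j + r) = g j) ∧
      (∀ j, (g j : ZMod (p ^ r - 1)) = (p : ZMod (p ^ r - 1)) ^ j * e) ∧
      (e ≠ 0 → ∀ j, g j ≠ 0) ∧
      ∑ j ∈ range r, g j = (p.digits e).sum * ∑ j ∈ range r, p ^ j := by
  induction e using Nat.strong_induction_on with
  | _ e ih =>
    rcases Nat.eq_zero_or_pos e with rfl | he
    · exact ⟨fun _ ↦ 0, by simp⟩
    obtain ⟨g, hper, hmod, hne, hsum⟩ := ih (e / p) (Nat.div_lt_self he hp)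
    have hpr : (p : ZMod (p ^ r - 1)) ^ r = 1 := by
      have h : ((p ^ r - 1 : ℕ) : ZMod (p ^ r - 1)) = 0 := ZMod.natCast_self _
      rwa [Nat.cast_sub (Nat.one_le_pow _ _ (by lia)), Nat.cast_pow, Nat.cast_one,
        sub_eq_zero] at h
    have hdiv := Nat.mod_add_div e p
    refine ⟨fun j ↦ e % p * p ^ (j % r) + g (j + 1), fun j ↦ ?_, fun j ↦ ?_, fun _ j ↦ ?_, ?_⟩
    · simp [add_right_comm j r 1, hper]
    · have he' : (e : ZMod (p ^ r - 1)) = (e % p : ℕ) + p * (e / p : ℕ) := by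
        exact_mod_cast congrArg _ hdiv.symm
      rw [Nat.cast_add, hmod, Nat.cast_mul, Nat.cast_pow, ← pow_eq_pow_mod j hpr, he']
      ring
    · by_cases h : e / p = 0
      · have h0 : e % p ≠ 0 := by
          intro h'
          simp [h, h'] at hdiv
          lia
        have := Nat.mul_pos (Nat.pos_of_ne_zero h0) (pow_pos (by lia : 0 < p) (j % r))
        dsimp only
        lia
      · have := hne h (j + 1)
        dsimp only
        lia
    · have hshift : ∑ j ∈ range r, g (j + 1) = ∑ j ∈ range r, g j := by
        have h₁ := sum_range_succ g r
        have h₂ := sum_range_succ' g r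
        have h₃ := hper 0
        rw [zero_add] at h₃
        lia
      have hmod' : ∑ j ∈ range r, p ^ (j % r) = ∑ j ∈ range r, p ^ j :=
        sum_congr rfl fun j hj ↦ by rw [Nat.mod_eq_of_lt (mem_range.mp hj)]
      rw [sum_add_distrib, ← mul_sum, hshift, hmod', hsum, Nat.digits_def' hp he, List.sum_cons,
        add_mul]

/-- Legendre's formula for multinomial coefficients. -/
theorem sub_one_mul_padicValNat_multinomial {ι : Type*} (p : ℕ) [hp : Fact p.Prime]
    (s : Finset ι) (e : ι → ℕ) :
    (p - 1) * padicValNat p (Nat.multinomial s e) + (p.digits (∑ i ∈ s, e i)).sum =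
      ∑ i ∈ s, (p.digits (e i)).sum := by
  have legendre (n : ℕ) : (p - 1) * padicValNat p n.factorial + (p.digits n).sum = n := by
    rw [sub_one_mul_padicValNat_factorial, Nat.sub_add_cancel (Nat.digit_sum_le p n)]
  have hprod : padicValNat p (∏ i ∈ s, (e i).factorial) =
      ∑ i ∈ s, padicValNat p (e i).factorial := by
    classical
    induction s using Finset.induction_on with
    | empty => simp
    | insert a s ha ih =>
      rw [prod_insert ha, sum_insert ha, padicValNat.mul (Nat.factorial_ne_zero _)
        (prod_ne_zero_iff.mpr fun i _ ↦ Nat.factorial_ne_zero _), ih]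
  have hspec := congrArg (padicValNat p) (Nat.multinomial_spec s e)
  rw [padicValNat.mul (prod_ne_zero_iff.mpr fun i _ ↦ Nat.factorial_ne_zero _)
    (Nat.multinomial_pos s e).ne', hprod] at hspec
  have htotal := legendre (∑ i ∈ s, e i)
  have hparts : ∑ i ∈ s, ((p - 1) * padicValNat p (e i).factorial + (p.digits (e i)).sum) =
      ∑ i ∈ s, e i := sum_congr rfl fun i _ ↦ legendre (e i)
  rw [sum_add_distrib, ← mul_sum] at hparts
  rw [← hspec, mul_add] at htotal
  lia

theorem digits_sum_pow_sub_one_mul_pow_le {p : ℕ} (hp : 1 < p) (r t : ℕ) :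
    (p.digits ((p ^ r - 1) * p ^ t)).sum ≤ r * (p - 1) := by
  rcases Nat.eq_zero_or_pos (p ^ r - 1) with h | h
  · simp [h]
  rw [mul_comm, Nat.digits_base_pow_mul hp h, List.sum_append, List.sum_replicate, smul_zero,
    zero_add]
  calc (p.digits (p ^ r - 1)).sum ≤ (p.digits (p ^ r - 1)).length • (p - 1) :=
        List.sum_le_card_nsmul _ _ fun x hx ↦ Nat.le_sub_one_of_lt (Nat.digits_lt_base hp hx)
    _ ≤ r * (p - 1) := by
        rw [smul_eq_mul]
        gcongr
        rw [Nat.digits_length_le_iff hp]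
        lia

/-- If the exponents `∑ m ∈ s, e m * m i` are positive multiples of `p ^ r - 1`, with monomials `m`
of degree less than the number of variables, then the multinomial coefficient of `e` is divisible
by `p ^ r`. -/
theorem pow_dvd_multinomial {σ : Type*} [Fintype σ] {p r : ℕ} [hp : Fact p.Prime] (hr : 0 < r)
    {s : Finset (σ →₀ ℕ)} (hs : ∀ m ∈ s, ∑ i, m i < Fintype.card σ) {e : (σ →₀ ℕ) → ℕ} {t : ℕ}
    (he : ∑ m ∈ s, e m = (p ^ r - 1) * p ^ t)
    (hpos : ∀ i, ∑ m ∈ s, e m * m i ≠ 0)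
    (hdvd : ∀ i, p ^ r - 1 ∣ ∑ m ∈ s, e m * m i) :
    p ^ r ∣ Nat.multinomial s e := by
  have hp1 : 1 < p := hp.out.one_lt
  have hq : 0 < p ^ r - 1 := Nat.sub_pos_of_lt (Nat.one_lt_pow hr.ne' hp1)
  choose g _ hmod hne hsum using fun m : σ →₀ ℕ ↦ exists_cyclic_digit_shifts hp1 r (e m)
  have hbound (j : ℕ) : 2 * (p ^ r - 1) ≤ ∑ m ∈ s, g m j := by
    have htot : p ^ r - 1 ∣ ∑ m ∈ s, g m j := by
      rw [← ZMod.natCast_eq_zero_iff, Nat.cast_sum]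
      simp_rw [hmod]
      rw [← mul_sum, ← Nat.cast_sum, he, Nat.cast_mul, ZMod.natCast_self, zero_mul, mul_zero]
    have hvar (i : σ) : p ^ r - 1 ≤ ∑ m ∈ s, g m j * m i := by
      apply Nat.le_of_dvd
      · obtain ⟨m, hm, hmi⟩ := exists_ne_zero_of_sum_ne_zero (hpos i)
        rw [mul_ne_zero_iff] at hmi
        exact sum_pos' (fun _ _ ↦ Nat.zero_le _)
          ⟨m, hm, Nat.pos_of_ne_zero (mul_ne_zero (hne m hmi.1 j) hmi.2)⟩
      · rw [← ZMod.natCast_eq_zero_iff, Nat.cast_sum]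
        simp_rw [Nat.cast_mul, hmod, mul_assoc]
        rw [← mul_sum]
        have := (ZMod.natCast_eq_zero_iff _ _).mpr (hdvd i)
        push_cast at this
        rw [this, mul_zero]
    have hlow : Fintype.card σ * (p ^ r - 1) ≤ ∑ m ∈ s, g m j * ∑ i, m i := by
      simp_rw [mul_sum]
      rw [sum_comm, ← smul_eq_mul]
      exact card_nsmul_le_sum _ _ _ fun i _ ↦ hvar i
    have hup : ∑ m ∈ s, g m j * ∑ i, m i ≤ (∑ m ∈ s, g m j) * (Fintype.card σ - 1) := by
      rw [sum_mul]
      exact sum_le_sum fun m hm ↦ Nat.mul_le_mul_left _ (Nat.le_sub_one_of_lt (hs m hm))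
    obtain ⟨c, hc⟩ := htot
    rw [hc] at hup ⊢
    have hcard : Fintype.card σ ≤ c * (Fintype.card σ - 1) := by
      refine Nat.le_of_mul_le_mul_left ?_ hq
      nlinarith [hlow.trans hup]
    have hc2 : 2 ≤ c := by
      by_contra! h
      have : σ → False := fun i ↦ by
        have : 0 < Fintype.card σ := Fintype.card_pos_iff.mpr ⟨i⟩
        interval_cases c <;> lia
      have hempty : IsEmpty σ := ⟨this⟩
      obtain ⟨m, hm, -⟩ := exists_ne_zero_of_sum_ne_zero (f := e) (s := s)
        (by rw [he]; exact (Nat.mul_pos hq (pow_pos (by lia) t)).ne')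
      simpa using hs m hm
    nlinarith
  have hdigits : r * (2 * (p - 1)) ≤ ∑ m ∈ s, (p.digits (e m)).sum := by
    have hgeom : (∑ j ∈ range r, p ^ j) * (p - 1) = p ^ r - 1 := by
      rw [Nat.geomSum_eq hp1, Nat.div_mul_cancel (by simpa using Nat.sub_dvd_pow_sub_pow p 1 r)]
    have hG : 0 < ∑ j ∈ range r, p ^ j :=
      Nat.pos_of_mul_pos_right (hgeom ▸ hq)
    refine Nat.le_of_mul_le_mul_right ?_ hG
    calc r * (2 * (p - 1)) * ∑ j ∈ range r, p ^ j = (range r).card • (2 * (p ^ r - 1)) := by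
          rw [← hgeom, card_range, smul_eq_mul]; ring
      _ ≤ ∑ j ∈ range r, ∑ m ∈ s, g m j := card_nsmul_le_sum _ _ _ fun j _ ↦ hbound j
      _ = (∑ m ∈ s, (p.digits (e m)).sum) * ∑ j ∈ range r, p ^ j := by
          rw [sum_comm, sum_mul]
          exact sum_congr rfl fun m _ ↦ hsum m
  have hval := sub_one_mul_padicValNat_multinomial p s e
  have htop := digits_sum_pow_sub_one_mul_pow_le hp1 r t
  rw [← he] at htop
  rw [padicValNat_dvd_iff_le (Nat.multinomial_pos s e).ne']
  refine Nat.le_of_mul_le_mul_left ?_ (Nat.sub_pos_of_lt hp1)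
  nlinarith

theorem WittVector.p_dvd_iff_constantCoeff_eq_zero {p : ℕ} [Fact p.Prime] {k : Type*} [CommRing k]
    [CharP k p] [PerfectRing k p] (x : WittVector p k) :
    (p : WittVector p k) ∣ x ↔ WittVector.constantCoeff x = 0 := by
  rw [← RingHom.mem_ker, WittVector.ker_constantCoeff, Ideal.mem_span_singleton]

theorem WittVector.natCast_p_pow_dvd {p : ℕ} [hp : Fact p.Prime] {k : Type*} [Field k]
    [CharP k p] [PerfectRing k p] (r N : ℕ) (h : (p : WittVector p k) ^ r ∣ N) : p ^ r ∣ N := by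
  induction r generalizing N with
  | zero => simp
  | succ r ih =>
    have hN : p ∣ N := by
      rw [← CharP.cast_eq_zero_iff k p, ← map_natCast (WittVector.constantCoeff (p := p) (R := k)),
        ← WittVector.p_dvd_iff_constantCoeff_eq_zero]
      exact (dvd_pow_self _ r.succ_ne_zero).trans h
    obtain ⟨M, rfl⟩ := hN
    rw [pow_succ', Nat.cast_mul, mul_dvd_mul_iff_left (WittVector.p_nonzero p k)] at h
    rw [pow_succ']
    exact mul_dvd_mul_left p (ih M h)

/-- Power sums of Teichmüller representatives over a finite field. -/
theorem card_dvd_sum_teichmuller_pow {p : ℕ} [Fact p.Prime] {k : Type*} [Field k] [Fintype k]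
    [CharP k p] (M : ℕ) (hM : M ≠ 0 → ¬ Fintype.card k - 1 ∣ M) :
    (Fintype.card k : WittVector p k) ∣ ∑ y : k, WittVector.teichmuller p y ^ M := by
  by_cases h0 : M = 0
  · simp [h0]
  have hcyc := hM h0
  rw [← FiniteField.forall_pow_eq_one_iff] at hcyc
  push Not at hcyc
  obtain ⟨u, hu⟩ := hcyc
  have hinv : WittVector.teichmuller p (u : k) ^ M * ∑ y : k, WittVector.teichmuller p y ^ M =
      ∑ y : k, WittVector.teichmuller p y ^ M := by
    rw [mul_sum, ← Equiv.sum_comp u.mulLeft fun y : k ↦ WittVector.teichmuller p y ^ M]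
    simp [mul_pow]
  have hne : WittVector.teichmuller p (u : k) ^ M ≠ 1 := by
    intro h
    apply hu
    have := congrArg WittVector.constantCoeff h
    rw [map_pow, map_one] at this
    exact Units.ext (by simpa using this)
  by_cases hzero : ∑ y : k, WittVector.teichmuller p y ^ M = 0
  · exact hzero ▸ dvd_zero _
  · exact absurd ((mul_eq_right₀ hzero).mp hinv) hne

/-- The sum over all points of a suitable power of the Teichmüller lift of a polynomial `f` over a
field with `p ^ r` elements is divisible by `p ^ r`, when `f` has total degree less than the number
of variables. -/
theorem pow_dvd_sum_teichmuller_lift_pow {k σ : Type*} [Field k] [Fintype k] [Fintype σ]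
    [DecidableEq σ] {p r : ℕ} [Fact p.Prime] [CharP k p] (hr : 0 < r)
    (hcard : Fintype.card k = p ^ r) (f : MvPolynomial σ k) (hf : f.totalDegree < Fintype.card σ) (t : ℕ) :
    (p : WittVector p k) ^ r ∣ ∑ x : σ → k, (∑ m ∈ f.support,
      WittVector.teichmuller p (f.coeff m) *
        ∏ i, WittVector.teichmuller p (x i) ^ m i) ^ ((p ^ r - 1) * p ^ t) := by
  classical
  set τ := WittVector.teichmuller p (R := k)
  set E := (p ^ r - 1) * p ^ t
  have hexpand (x : σ → k) : (∑ m ∈ f.support, τ (f.coeff m) * ∏ i, τ (x i) ^ m i) ^ E =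
      ∑ e ∈ piAntidiag f.support E,
      (Nat.multinomial f.support e : WittVector p k) * (∏ m ∈ f.support, τ (f.coeff m) ^ e m) *
        ∏ i, τ (x i) ^ ∑ m ∈ f.support, e m * m i := by
    rw [sum_pow_eq_sum_piAntidiag]
    refine sum_congr rfl fun e _ ↦ ?_
    simp_rw [mul_pow, prod_mul_distrib, mul_assoc, ← prod_pow, ← pow_mul]
    rw [prod_comm]
    simp_rw [prod_pow_eq_pow_sum, mul_comm]
  simp_rw [hexpand]
  rw [sum_comm]
  refine dvd_sum fun e he ↦ ?_
  rw [← mul_sum]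
  have hfactor : ∑ x : σ → k, ∏ i, τ (x i) ^ ∑ m ∈ f.support, e m * m i =
      ∏ i, ∑ y : k, τ y ^ ∑ m ∈ f.support, e m * m i := by
    rw [prod_univ_sum, Fintype.piFinset_univ]
  rw [hfactor]
  by_cases h : ∀ i, ∑ m ∈ f.support, e m * m i ≠ 0 ∧ p ^ r - 1 ∣ ∑ m ∈ f.support, e m * m i
  · have hs (m) (hm : m ∈ f.support) : ∑ i, m i < Fintype.card σ := by
      have := MvPolynomial.le_totalDegree hm
      rw [Finsupp.sum_fintype _ _ fun _ ↦ rfl] at this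
      exact this.trans_lt hf
    have hdvd := pow_dvd_multinomial hr hs (mem_piAntidiag.mp he).1 (fun i ↦ (h i).1)
      fun i ↦ (h i).2
    have hcast : (p : WittVector p k) ^ r ∣ Nat.multinomial f.support e := by
      exact_mod_cast Nat.cast_dvd_cast (α := WittVector p k) hdvd
    exact (hcast.mul_right _).mul_right _
  · push Not at h
    obtain ⟨i, hi⟩ := h
    have := card_dvd_sum_teichmuller_pow (p := p) (k := k) (∑ m ∈ f.support, e m * m i)
      (by rwa [hcard])
    rw [hcard, Nat.cast_pow] at this
    have hprod := dvd_prod_of_mem (fun i ↦ ∑ y : k, τ y ^ ∑ m ∈ f.support, e m * m i) (mem_univ i)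
    exact (this.trans hprod).mul_left _

/-- **Ax's theorem** for an affine hypersurface: a polynomial over a finite field `k` whose total
degree is less than the number of variables has a number of zeros divisible by the cardinality
of `k`. -/
theorem card_dvd_card_zeros {k σ : Type*} [Field k] [Fintype k] [Fintype σ]
    (f : MvPolynomial σ k) (hf : f.totalDegree < Fintype.card σ) :
    Fintype.card k ∣ Nat.card {x : σ → k // MvPolynomial.eval x f = 0} := by
  classical
  obtain ⟨p, hchar⟩ := CharP.exists k
  obtain ⟨⟨r, hr⟩, hpp, hcard⟩ := FiniteField.card k p
  have hp : Fact p.Prime := ⟨hpp⟩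
  rw [PNat.mk_coe] at hcard
  set τ := WittVector.teichmuller p (R := k)
  have hτ (y : k) : WittVector.constantCoeff (τ y) = y := rfl
  set E := (p ^ r - 1) * p ^ (r - 1)
  have hq : 0 < p ^ r - 1 := Nat.sub_pos_of_lt (Nat.one_lt_pow hr.ne' hpp.one_lt)
  have hrE : r ≤ E := by
    have : r - 1 < p ^ (r - 1) := Nat.lt_pow_self hpp.one_lt
    exact le_trans (by lia) (Nat.le_mul_of_pos_left _ hq)
  let F (x : σ → k) : WittVector p k := ∑ m ∈ f.support, τ (f.coeff m) * ∏ i, τ (x i) ^ m i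
  have hF (x : σ → k) : WittVector.constantCoeff (F x) = MvPolynomial.eval x f := by
    simp only [F, map_sum, map_mul, map_prod, map_pow, hτ, MvPolynomial.eval_eq']
  have hindicator (x : σ → k) : (p : WittVector p k) ^ r ∣
      (if MvPolynomial.eval x f = 0 then 1 else 0) - (1 - F x ^ E) := by
    split_ifs with hx
    · rw [sub_sub_cancel]
      have : (p : WittVector p k) ∣ F x := by
        rw [WittVector.p_dvd_iff_constantCoeff_eq_zero, hF, hx]
      exact (pow_dvd_pow _ hrE).trans (pow_dvd_pow_of_dvd this E)
    · have : (p : WittVector p k) ∣ F x ^ (p ^ r - 1) - 1 := by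
        rw [WittVector.p_dvd_iff_constantCoeff_eq_zero, map_sub, map_pow, hF, map_one, ← hcard,
          FiniteField.pow_card_sub_one_eq_one _ hx, sub_self]
      have h := dvd_sub_pow_of_dvd_sub this (r - 1)
      rw [Nat.sub_add_cancel hr, one_pow, ← pow_mul] at h
      simpa using h
  have hpow : (p : WittVector p k) ^ r ∣ ∑ x, F x ^ E :=
    pow_dvd_sum_teichmuller_lift_pow hr hcard f hf (r - 1)
  have hspace : (p : WittVector p k) ^ r ∣ ∑ _x : σ → k, 1 := by
    have hne : Fintype.card σ ≠ 0 := by lia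
    rw [sum_const, card_univ, Fintype.card_fun, hcard, nsmul_eq_mul, mul_one, ← Nat.cast_pow]
    exact Nat.cast_dvd_cast (dvd_pow_self _ hne)
  rw [hcard]
  apply WittVector.natCast_p_pow_dvd (k := k)
  have hcount : (Nat.card {x : σ → k // MvPolynomial.eval x f = 0} : WittVector p k) =
      ∑ x, if MvPolynomial.eval x f = 0 then 1 else 0 := by
    rw [Nat.card_eq_fintype_card, Fintype.card_subtype, sum_boole]
  rw [hcount]
  have hsum := dvd_sum fun x (_ : x ∈ univ) ↦ hindicator x
  rw [sum_sub_distrib, sum_sub_distrib] at hsum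
  exact (dvd_iff_dvd_of_dvd_sub hsum).mpr (dvd_sub hspace hpow)

theorem MvPolynomial.IsHomogeneous.eval_smul {R σ : Type*} [CommSemiring R] [Fintype σ]
    {f : MvPolynomial σ R} {d : ℕ} (hf : f.IsHomogeneous d) (c : R) (v : σ → R) :
    MvPolynomial.eval (c • v) f = c ^ d * MvPolynomial.eval v f := by
  rw [MvPolynomial.eval_eq', MvPolynomial.eval_eq', mul_sum]
  refine sum_congr rfl fun m hm ↦ ?_
  have hdeg : ∑ i, m i = d := by
    rw [← hf (MvPolynomial.mem_support_iff.mp hm), ← Finsupp.degree_eq_sum,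
      Finsupp.degree_eq_weight_one]
    rfl
  simp_rw [Pi.smul_apply, smul_eq_mul, mul_pow, prod_mul_distrib, prod_pow_eq_pow_sum, hdeg]
  ring

/-- The nonzero zeros of a homogeneous polynomial are partitioned into `kˣ`-orbits, one for each
point of the projective hypersurface. -/
theorem card_projective_zeros_mul_card_units {k σ : Type*} [Field k] [Fintype σ]
    {f : MvPolynomial σ k} {d : ℕ} (hf : f.IsHomogeneous d) :
    Nat.card {P : Projectivization k (σ → k) // ∃ (v : σ → k) (hv : v ≠ 0),
        P = Projectivization.mk k v hv ∧ MvPolynomial.eval v f = 0} * Nat.card kˣ =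
      Nat.card {v : σ → k // v ≠ 0 ∧ MvPolynomial.eval v f = 0} := by
  have hsmul (u : kˣ) {v : σ → k} (h : MvPolynomial.eval v f = 0) :
      MvPolynomial.eval (u • v) f = 0 := by
    rw [Units.smul_def, hf.eval_smul, h, mul_zero]
  rw [← Nat.card_prod]
  refine Nat.card_eq_of_bijective (fun x ↦ ⟨x.2 • x.1.1.rep,
    (smul_ne_zero_iff_ne x.2).mpr x.1.1.rep_nonzero, ?_⟩) ⟨?_, ?_⟩
  · obtain ⟨⟨P, v, hv, rfl, h⟩, u⟩ := x
    obtain ⟨a, ha⟩ := Projectivization.exists_smul_eq_mk_rep k v hv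
    exact hsmul u (ha ▸ hsmul a h)
  · rintro ⟨⟨P, hP⟩, u⟩ ⟨⟨Q, hQ⟩, w⟩ h
    have h : u • P.rep = w • Q.rep := congrArg Subtype.val h
    obtain rfl : P = Q := by
      rw [← P.mk_rep, ← Q.mk_rep, Projectivization.mk_eq_mk_iff]
      exact ⟨u⁻¹ * w, by rw [mul_smul, ← h, inv_smul_smul]⟩
    obtain rfl : u = w := Units.ext (smul_left_injective k P.rep_nonzero h)
    rfl
  · rintro ⟨v, hv, h⟩
    obtain ⟨a, ha⟩ := Projectivization.exists_smul_eq_mk_rep k v hv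
    refine ⟨⟨⟨Projectivization.mk k v hv, v, hv, rfl, h⟩, a⁻¹⟩, Subtype.ext ?_⟩
    simp only [← ha, inv_smul_smul]

/-- **Ax's theorem**. Over a finite field `k` of cardinality `q`, a projective hypersurface
of degree `d ≤ n` in `ℙⁿ` has a number of `k`-points congruent to `1` modulo `q`. The
`k`-points are the classes, modulo scalar multiplication, of nonzero vectors
`v ∈ k^{n+1}` with `f v = 0`. -/
theorem ax_projective_hypersurface
    (q : ℕ) (k : Type) [Field k] [Fintype k] (hq : Fintype.card k = q)
    (n d : ℕ) (hd : 1 ≤ d) (hdn : d ≤ n)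
    (f : MvPolynomial (Fin (n + 1)) k) (hf : f.IsHomogeneous d) :
    Nat.card {P : Projectivization k (Fin (n + 1) → k) //
        ∃ (v : Fin (n + 1) → k) (hv : v ≠ 0),
          P = Projectivization.mk k v hv ∧ MvPolynomial.eval v f = 0} ≡ 1 [MOD q] := by
  classical
  subst hq
  have hzero : MvPolynomial.eval (0 : Fin (n + 1) → k) f = 0 := by
    simpa [Nat.ne_of_gt hd] using hf.eval_smul 0 0
  have haffine := card_dvd_card_zeros f (by
    rw [Fintype.card_fin]
    exact hf.totalDegree_le.trans_lt (by lia))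
  have hsplit : Nat.card {v : Fin (n + 1) → k // MvPolynomial.eval v f = 0} =
      Nat.card {v : Fin (n + 1) → k // v ≠ 0 ∧ MvPolynomial.eval v f = 0} + 1 := by
    simp_rw [Nat.card_eq_fintype_card, Fintype.card_subtype]
    rw [← card_erase_add_one (a := 0) (by simpa using hzero)]
    congr 2
    ext v
    simp
  rw [hsplit, ← card_projective_zeros_mul_card_units hf, Nat.card_units,
    Nat.card_eq_fintype_card (α := k)] at haffine
  have hpos : 1 ≤ Fintype.card k := Fintype.card_pos
  rw [Nat.modEq_iff_dvd]
  have h := Int.natCast_dvd_natCast.mpr haffine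
  push_cast [hpos] at h
  rw [mul_sub, mul_one, sub_add, sub_eq_add_neg, neg_sub] at h
  exact (dvd_add_right (dvd_mul_left _ _)).mp h
end

section
/- Let k be an algebraically closed field and let f be a homogeneous polynomial of degree d in the n+1 variables x_0, …, x_n with coefficients in the field k(t) of rational functions in one variable over k. If 1 ≤ d ≤ n, then the equation f = 0 admits a solution (x_0, …, x_n) ∈ k(t)^{n+1} \ {(0,…,0)}. -/
namespace MvPolynomial

/-- Killing a finite set `s` of variables defines a prime ideal of height at least `s.card`. -/
lemma card_le_height_ker_aeval_ite {σ k : Type*} [Field k] [DecidableEq σ] (s : Finset σ) :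
    (s.card : ℕ∞) ≤ (RingHom.ker (aeval (R := k) fun j ↦
      if j ∈ s then (0 : MvPolynomial σ k) else X j)).height := by
  induction s using Finset.induction_on with
  | empty => simp
  | insert a s ha ih =>
    set φ := aeval (R := k) fun j ↦ if j ∈ s then (0 : MvPolynomial σ k) else X j with hφ
    set ψ := aeval (R := k) fun j ↦ if j ∈ insert a s then (0 : MvPolynomial σ k) else X j with hψ
    have hcomp : ψ.comp φ = ψ := by
      ext1 j
      by_cases hj : j ∈ s <;> simp [hφ, hψ, hj]
    have hlt : RingHom.ker φ < RingHom.ker ψ := by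
      refine lt_of_le_not_ge (fun p hp ↦ ?_) fun hle ↦ ?_
      · rw [RingHom.mem_ker] at hp ⊢
        rw [← hcomp, AlgHom.comp_apply, hp, map_zero]
      · have hX : (X a : MvPolynomial σ k) ∈ RingHom.ker φ :=
          hle (by simp [RingHom.mem_ker, hψ])
        simp [RingHom.mem_ker, hφ, ha] at hX
    have : (RingHom.ker φ).IsPrime := RingHom.ker_isPrime _
    have : (RingHom.ker ψ).IsPrime := RingHom.ker_isPrime _
    rw [Finset.card_insert_of_notMem ha, Nat.cast_add, Nat.cast_one]
    exact (add_le_add_left ih 1).trans (Ideal.height_add_one_le_of_lt_of_isPrime hlt)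

lemma card_le_height_vanishingIdeal_zero (σ k : Type*) [Field k] [Fintype σ] :
    (Fintype.card σ : ℕ∞) ≤ (vanishingIdeal k {(0 : σ → k)}).height := by
  classical
  refine (card_le_height_ker_aeval_ite (k := k) Finset.univ).trans (Ideal.height_mono fun p hp ↦ ?_)
  rw [mem_vanishingIdeal_singleton_iff]
  rw [RingHom.mem_ker] at hp
  have h := congrArg (aeval (R := k) (0 : σ → k)) hp
  rw [← AlgHom.comp_apply, comp_aeval] at h
  simpa using h

/-- Over an algebraically closed field, fewer polynomials than variables, all vanishing at the
origin, have a common zero other than the origin. -/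
theorem exists_ne_zero_forall_eval_eq_zero {σ k : Type*} [Field k] [IsAlgClosed k] [Fintype σ]
    (s : Finset (MvPolynomial σ k)) (hs : s.card < Fintype.card σ) (h0 : ∀ p ∈ s, eval 0 p = 0) :
    ∃ x : σ → k, x ≠ 0 ∧ ∀ p ∈ s, eval x p = 0 := by
  by_contra! hne
  have hlocus : zeroLocus k (Ideal.span (s : Set (MvPolynomial σ k))) = {0} := by
    rw [zeroLocus_span]
    ext x
    simp only [Finset.mem_coe, aeval_eq_eval, Set.mem_ofPred, Set.mem_singleton_iff]
    refine ⟨fun hx ↦ ?_, fun hx ↦ hx ▸ h0⟩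
    by_contra hx0
    obtain ⟨p, hp, hpx⟩ := hne x hx0
    exact hpx (hx p hp)
  have hrad := vanishingIdeal_zeroLocus_eq_radical (K := k)
    (Ideal.span (s : Set (MvPolynomial σ k)))
  rw [hlocus] at hrad
  have hprime : (vanishingIdeal k {(0 : σ → k)}).IsPrime :=
    (inferInstance : (vanishingIdeal k {(0 : σ → k)}).IsMaximal).isPrime
  have hmin : vanishingIdeal k {(0 : σ → k)} ∈
      (Ideal.span (s : Set (MvPolynomial σ k))).minimalPrimes := by
    rw [← Ideal.radical_minimalPrimes, ← hrad, Ideal.minimalPrimes_eq_subsingleton_self]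
    exact Set.mem_singleton _
  have hle := (card_le_height_vanishingIdeal_zero σ k).trans
    (Ideal.height_le_card_of_mem_minimalPrimes_span_finset hmin)
  exact absurd (Nat.cast_le.mp hle) (not_le.mpr hs)

/-- Substituting polynomials of degree at most `s` into a homogeneous form of degree `d` whose
coefficients have degree at most `D` gives a polynomial of degree at most `D + d * s`. -/
lemma IsHomogeneous.natDegree_eval₂_le {σ R S : Type*} [Fintype σ] [CommSemiring R]
    [CommSemiring S] {g : MvPolynomial σ R} {d : ℕ} (hg : g.IsHomogeneous d)
    (φ : R →+* Polynomial S) (y : σ → Polynomial S) {D s : ℕ}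
    (hD : ∀ m ∈ g.support, (φ (g.coeff m)).natDegree ≤ D) (hy : ∀ i, (y i).natDegree ≤ s) :
    (g.eval₂ φ y).natDegree ≤ D + d * s := by
  rw [eval₂_eq']
  refine Polynomial.natDegree_sum_le_of_forall_le _ _ fun m hm ↦
    Polynomial.natDegree_mul_le.trans (add_le_add (hD m hm) ?_)
  have hdeg : ∑ i, m i = d := by
    rw [← Finsupp.degree_eq_sum, Finsupp.degree_eq_weight_one]
    exact hg (mem_support_iff.mp hm)
  calc (∏ i, y i ^ m i).natDegree ≤ ∑ i, (y i ^ m i).natDegree := Polynomial.natDegree_prod_le _ _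
    _ ≤ ∑ i, m i * s := Finset.sum_le_sum fun i _ ↦
      Polynomial.natDegree_pow_le.trans (Nat.mul_le_mul_left _ (hy i))
    _ = d * s := by rw [← Finset.sum_mul, hdeg]

/-- A form of degree `1 ≤ d ≤ n` in `n + 1` variables over `k[t]`, with `k` algebraically closed,
has a nontrivial zero over `k[t]`. -/
theorem IsHomogeneous.exists_polynomial_eval_eq_zero {k : Type*} [Field k] [IsAlgClosed k]
    {n d : ℕ} (hd : 1 ≤ d) (hdn : d ≤ n) {g : MvPolynomial (Fin (n + 1)) (Polynomial k)}
    (hg : g.IsHomogeneous d) :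
    ∃ x : Fin (n + 1) → Polynomial k, x ≠ 0 ∧ eval x g = 0 := by
  classical
  set D := g.support.sup fun m ↦ (g.coeff m).natDegree
  let S := MvPolynomial (Fin (n + 1) × Fin (D + 1)) k
  let y : Fin (n + 1) → Polynomial S := fun i ↦
    ∑ j : Fin (D + 1), Polynomial.C (X (i, j)) * Polynomial.X ^ (j : ℕ)
  let G : Polynomial S := g.eval₂ (Polynomial.mapRingHom C) y
  have hGdeg : G.natDegree ≤ D + d * D := by
    refine hg.natDegree_eval₂_le _ _ (fun m hm ↦ ?_) fun i ↦ ?_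
    · exact Polynomial.natDegree_map_le.trans
        (Finset.le_sup (f := fun m ↦ (g.coeff m).natDegree) hm)
    · exact Polynomial.natDegree_sum_le_of_forall_le _ _ fun j _ ↦
        (Polynomial.natDegree_C_mul_X_pow_le _ _).trans (Nat.lt_succ_iff.mp j.2)
  let x (a : Fin (n + 1) × Fin (D + 1) → k) (i : Fin (n + 1)) : Polynomial k :=
    ∑ j : Fin (D + 1), Polynomial.C (a (i, j)) * Polynomial.X ^ (j : ℕ)
  have hGx (a) : G.map (eval a) = eval (x a) g := by
    have hy : (fun i ↦ (y i).map (eval a)) = x a := by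
      funext i
      simp [y, x, Polynomial.map_sum]
    have hC : (Polynomial.mapRingHom (eval a)).comp (Polynomial.mapRingHom C) =
        RingHom.id (Polynomial k) := by
      ext <;> simp
    have := eval₂_comp_left (Polynomial.mapRingHom (eval a)) (Polynomial.mapRingHom C) y g
    rw [hC] at this
    rw [← hy]
    exact this
  have h0 : x 0 = 0 := by
    funext i
    simp [x]
  have hg0 : eval (0 : Fin (n + 1) → Polynomial k) g = 0 := by
    rw [eval_zero]
    exact hg.coeff_eq_zero (by rw [map_zero]; omega)
  obtain ⟨a, ha, hzero⟩ := exists_ne_zero_forall_eval_eq_zero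
    ((Finset.range (D + d * D + 1)).image G.coeff)
    (Finset.card_image_le.trans_lt (by
      simp only [Finset.card_range, Fintype.card_prod, Fintype.card_fin]
      nlinarith [Nat.mul_le_mul_right D hdn])) (by
      simp only [Finset.mem_image, forall_exists_index, and_imp]
      rintro _ m - rfl
      rw [← Polynomial.coeff_map, hGx, h0, hg0, Polynomial.coeff_zero])
  refine ⟨x a, fun hx ↦ ha ?_, ?_⟩
  · funext ⟨i, j⟩
    have := congrArg (fun p : Polynomial k ↦ p.coeff j) (congrFun hx i)
    simpa [x, Polynomial.finsetSum_coeff, Polynomial.coeff_X_pow, Fin.val_inj] using this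
  · rw [← hGx]
    ext m
    rw [Polynomial.coeff_map, Polynomial.coeff_zero]
    by_cases hm : m < D + d * D + 1
    · exact hzero _ (Finset.mem_image_of_mem _ (Finset.mem_range.mpr hm))
    · rw [Polynomial.coeff_eq_zero_of_natDegree_lt (by omega), map_zero]

attribute [local instance] algebraMvPolynomial in
/-- Denominators of a polynomial over a localization can be cleared. -/
lemma exists_map_eq_C_mul {σ R : Type*} [CommRing R] (M : Submonoid R) {K : Type*} [CommRing K]
    [Algebra R K] [IsLocalization M K] (f : MvPolynomial σ K) :
    ∃ c ∈ M, ∃ g : MvPolynomial σ R, map (algebraMap R K) g = C (algebraMap R K c) * f := by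
  obtain ⟨⟨g, c, hc⟩, h⟩ := IsLocalization.surj (M.map (C (σ := σ))) f
  obtain ⟨c, hc, rfl⟩ := hc
  refine ⟨c, hc, g, ?_⟩
  rw [algebraMap_def, map_C, mul_comm] at h
  exact h.symm

end MvPolynomial

/-- **Tsen's theorem**. Let `k` be an algebraically closed field. Every homogeneous
polynomial of degree `d` with `1 ≤ d ≤ n` in `n+1` variables over the rational function
field `k(t)` has a nontrivial zero. -/
theorem tsen_theorem (k : Type*) [Field k] [IsAlgClosed k]
    (n d : ℕ) (hd : 1 ≤ d) (hdn : d ≤ n)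
    (f : MvPolynomial (Fin (n + 1)) (RatFunc k)) (hf : f.IsHomogeneous d) :
    ∃ x : Fin (n + 1) → RatFunc k, x ≠ 0 ∧ MvPolynomial.eval x f = 0 := by
  have hinj : Function.Injective (algebraMap (Polynomial k) (RatFunc k)) :=
    IsFractionRing.injective _ _
  obtain ⟨c, hc, g, hgf⟩ := MvPolynomial.exists_map_eq_C_mul (nonZeroDivisors (Polynomial k)) f
  have hc0 : algebraMap (Polynomial k) (RatFunc k) c ≠ 0 :=
    (map_ne_zero_iff _ hinj).mpr (nonZeroDivisors.ne_zero hc)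
  have hg : g.IsHomogeneous d := by
    refine .of_map hinj ?_
    rw [hgf]
    exact hf.C_mul _
  obtain ⟨x, hx, hgx⟩ := hg.exists_polynomial_eval_eq_zero hd hdn
  refine ⟨fun i ↦ algebraMap _ _ (x i), fun h ↦ hx ?_, ?_⟩
  · funext i
    exact hinj (by simpa using congrFun h i)
  · have h : MvPolynomial.eval (fun i ↦ algebraMap _ (RatFunc k) (x i))
        (MvPolynomial.map (algebraMap (Polynomial k) (RatFunc k)) g) = 0 := by
      rw [MvPolynomial.eval_map, ← Function.comp_def, ← MvPolynomial.eval₂_comp, hgx, map_zero]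
    rw [hgf, map_mul, MvPolynomial.eval_C] at h
    exact (mul_eq_zero.mp h).resolve_left hc0
end

section
/- Let k'/k be an extension of fields whose transcendence degree equals a natural number d, and let i be a natural number. If k is a C_i field, then k' is a C_{i+d} field. -/
/-- A field `K` is `C_i` if every homogeneous polynomial of degree `m ≥ 1` in `n+1`
variables with `m ^ i ≤ n` has a nontrivial zero over `K`. -/
def IsCField (i : ℕ) (K : Type*) [Field K] : Prop :=
  ∀ (n m : ℕ), 1 ≤ m → m ^ i ≤ n →
    ∀ f : MvPolynomial (Fin (n + 1)) K, f.IsHomogeneous m →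
      ∃ x : Fin (n + 1) → K, x ≠ 0 ∧ MvPolynomial.eval x f = 0

universe u

open MvPolynomial

section AlgClosed

variable {K σ : Type*} [Field K]

/-- The ideal of polynomials vanishing on the coordinate subspace where the coordinates in `s`
are zero. -/
noncomputable def coordinateIdeal (K : Type*) {σ : Type*} [Field K] [DecidableEq σ]
    (s : Finset σ) : Ideal (MvPolynomial σ K) :=
  RingHom.ker (aeval (fun j => if j ∈ s then 0 else X j) :
    MvPolynomial σ K →ₐ[K] MvPolynomial σ K)

instance coordinateIdeal_isPrime [DecidableEq σ] (s : Finset σ) :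
    (coordinateIdeal K s).IsPrime :=
  RingHom.ker_isPrime _

theorem card_le_height_coordinateIdeal [DecidableEq σ] (s : Finset σ) :
    (s.card : ℕ∞) ≤ (coordinateIdeal K s).height := by
  induction s using Finset.induction_on with
  | empty => simp
  | insert a s ha ih =>
    have hlt : coordinateIdeal K s < coordinateIdeal K (insert a s) := by
      refine lt_of_le_of_ne (fun p hp => ?_) (fun h => ?_)
      · have hcomp : (aeval (fun j => if j ∈ insert a s then 0 else X j) :
            MvPolynomial σ K →ₐ[K] MvPolynomial σ K) =
            (aeval (fun j => if j ∈ insert a s then 0 else X j)).comp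
              (aeval (fun j => if j ∈ s then 0 else X j)) := by
          ext1 j
          by_cases hj : j ∈ s <;> simp [hj]
        have hp' : aeval (fun j => if j ∈ s then (0 : MvPolynomial σ K) else X j) p = 0 := hp
        change aeval (fun j => if j ∈ insert a s then (0 : MvPolynomial σ K) else X j) p = 0
        rw [hcomp, AlgHom.comp_apply, hp', map_zero]
      · have hmem : (X a : MvPolynomial σ K) ∈ coordinateIdeal K (insert a s) := by
          simp [coordinateIdeal, RingHom.mem_ker]
        rw [← h] at hmem
        simp [coordinateIdeal, RingHom.mem_ker, ha] at hmem
    rw [Finset.card_insert_of_notMem ha]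
    push_cast
    exact (add_le_add_left ih 1).trans (Ideal.height_add_one_le_of_lt_of_isPrime hlt)

theorem card_le_height_vanishingIdeal_zero [Fintype σ] :
    (Fintype.card σ : ℕ∞) ≤ (vanishingIdeal K {(0 : σ → K)}).height := by
  classical
  refine (card_le_height_coordinateIdeal (K := K) Finset.univ).trans (Ideal.height_mono ?_)
  intro p hp
  have hp' : aeval (0 : σ → MvPolynomial σ K) p = 0 := by
    simpa only [coordinateIdeal, RingHom.mem_ker, Finset.mem_univ, if_true, ← Pi.zero_def]
      using hp
  rw [mem_vanishingIdeal_singleton_iff]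
  rw [MvPolynomial.aeval_zero] at hp' ⊢
  simpa using hp'

/-- Over an algebraically closed field, fewer polynomials without constant term than variables
have a common nontrivial zero. -/
theorem IsAlgClosed.exists_common_zero [IsAlgClosed K] {ι : Type*} [Fintype ι] [Fintype σ]
    (f : ι → MvPolynomial σ K) (hf : ∀ p, eval 0 (f p) = 0)
    (hcard : Fintype.card ι < Fintype.card σ) :
    ∃ x : σ → K, x ≠ 0 ∧ ∀ p, eval x (f p) = 0 := by
  classical
  by_contra! hcon
  have hlocus : zeroLocus K (Ideal.span (Set.range f)) = {(0 : σ → K)} := by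
    ext x
    simp only [zeroLocus_span, Set.mem_ofPred_eq, Set.forall_mem_range, Set.mem_singleton_iff]
    constructor
    · intro hx
      by_contra hne
      obtain ⟨p, hp⟩ := hcon x hne
      exact hp (by simpa using hx p)
    · rintro rfl p
      simpa using hf p
  have hrad : (Ideal.span (Set.range f)).radical = vanishingIdeal K {(0 : σ → K)} := by
    rw [← vanishingIdeal_zeroLocus_eq_radical (K := K), hlocus]
  have hmin : vanishingIdeal K {(0 : σ → K)} ∈ (Ideal.span (Set.range f)).minimalPrimes := by
    rw [← Ideal.radical_minimalPrimes, hrad, Ideal.minimalPrimes_eq_subsingleton_self]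
    rfl
  have h1 := Ideal.height_le_card_of_mem_minimalPrimes_span (Set.finite_range f) hmin
  have h2 := card_le_height_vanishingIdeal_zero (K := K) (σ := σ)
  have h3 : (Set.range f).ncard ≤ Fintype.card ι := by
    rw [← Set.image_univ, ← Nat.card_eq_fintype_card, ← Set.ncard_univ]
    exact Set.ncard_image_le
  have h4 : Fintype.card σ ≤ (Set.range f).ncard := by exact_mod_cast h2.trans h1
  omega

end AlgClosed

/-- The field `K` has a homogeneous polynomial of degree `D` in `M` variables without
nontrivial zeros. -/
def HasAnisotropicForm (K : Type*) [Field K] (M D : ℕ) : Prop :=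
  ∃ f : MvPolynomial (Fin M) K, f.IsHomogeneous D ∧ ∀ x, eval x f = 0 → x = 0

section Anisotropic

variable {K : Type*} [Field K]

theorem HasAnisotropicForm.of_fintype {σ : Type*} [Fintype σ] {D : ℕ} (f : MvPolynomial σ K)
    (hf : f.IsHomogeneous D) (hz : ∀ x, eval x f = 0 → x = 0) :
    HasAnisotropicForm K (Fintype.card σ) D := by
  refine ⟨rename (Fintype.equivFin σ) f, hf.rename_isHomogeneous, fun x hx => ?_⟩
  rw [eval_rename] at hx
  have h := hz _ hx
  ext j
  simpa using congrFun h ((Fintype.equivFin σ).symm j)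

theorem HasAnisotropicForm.exists_fintype {M D : ℕ} (h : HasAnisotropicForm K M D)
    {σ : Type*} [Fintype σ] (hσ : Fintype.card σ ≤ M) :
    ∃ f : MvPolynomial σ K, f.IsHomogeneous D ∧ ∀ x, eval x f = 0 → x = 0 := by
  classical
  obtain ⟨f, hf, hz⟩ := h
  obtain ⟨e⟩ : Nonempty (σ ↪ Fin M) := Function.Embedding.nonempty_of_card_le (by simpa)
  let g : Fin M → MvPolynomial σ K := fun j => if h : ∃ s, e s = j then X h.choose else 0
  have hg : ∀ s, g (e s) = X s := fun s => by
    have hs : ∃ s', e s' = e s := ⟨s, rfl⟩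
    simp only [g, dif_pos hs]
    rw [e.injective hs.choose_spec]
  refine ⟨aeval g f, ?_, fun x hx => ?_⟩
  · simpa using hf.aeval g (n := 1) (fun j => by
      by_cases h : ∃ s, e s = j
      · simp only [g, dif_pos h]; exact isHomogeneous_X _ _
      · simp only [g, dif_neg h]; exact isHomogeneous_zero _ _ _)
  · have h := hz (fun j => eval x (g j)) (by
      rw [← hx]
      exact (eval₂Hom_bind₁ (RingHom.id K) x g f).symm)
    ext s
    simpa [hg] using congrFun h (e s)

/-- If the forms `f p` of degree `m` have no common nontrivial zero, they can be substituted into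
an anisotropic form, using a fresh set of variables for each block of `card ι` slots. -/
theorem HasAnisotropicForm.comp {ι σ : Type*} [Fintype ι] [Fintype σ] {m : ℕ}
    (f : ι → MvPolynomial σ K) (hf : ∀ p, (f p).IsHomogeneous m)
    (hz : ∀ x, (∀ p, eval x (f p) = 0) → x = 0)
    {M D : ℕ} (h : HasAnisotropicForm K M D) {q : ℕ} (hq : Fintype.card ι * q ≤ M) :
    HasAnisotropicForm K (Fintype.card σ * q) (m * D) := by
  obtain ⟨g, hg, hgz⟩ := h.exists_fintype (σ := ι × Fin q) (by simpa using hq)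
  have key := HasAnisotropicForm.of_fintype (σ := σ × Fin q) (K := K) (D := m * D)
    (aeval (fun pj : ι × Fin q => rename (fun s => (s, pj.2)) (f pj.1)) g)
    (hg.aeval _ fun pj => (hf pj.1).rename_isHomogeneous) ?_
  · simpa using key
  · intro x hx
    have h := hgz (fun pj => eval (fun s => x (s, pj.2)) (f pj.1)) (by
      rw [← hx]
      refine Eq.trans ?_ (eval₂Hom_bind₁ (RingHom.id K) x _ g).symm
      congr 2
      ext pj
      exact (eval_rename _ _ _).symm)
    ext ⟨s, j⟩
    exact congrFun (hz (fun s => x (s, j)) fun p => congrFun h (p, j)) s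

theorem exists_hasAnisotropicForm_two (hK : ¬ IsAlgClosed K) :
    ∃ D, 1 ≤ D ∧ HasAnisotropicForm K 2 D := by
  have : ∃ p : Polynomial K, p.Monic ∧ Irreducible p ∧ ∀ x, p.eval x ≠ 0 := by
    by_contra! h
    exact hK (IsAlgClosed.of_exists_root K fun p hp hirr => h p hp hirr)
  obtain ⟨p, hmon, hirr, hroot⟩ := this
  have hdeg := hirr.natDegree_pos
  refine ⟨p.natDegree, hdeg, p.homogenize p.natDegree, p.isHomogeneous_homogenize,
    fun x hx => ?_⟩
  by_cases h1 : x 1 = 0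
  · have hx0 : x 0 ^ p.natDegree = 0 := by
      rw [← hx, Polynomial.homogenize]
      rw [map_sum, Finset.sum_eq_single (p.natDegree, 0)]
      · simp [eval_monomial, Finsupp.prod_fintype, hmon.leadingCoeff]
      · rintro ⟨a, b⟩ hab hne
        have hb : b ≠ 0 := by
          rintro rfl
          apply hne
          simpa using hab
        simp [eval_monomial, Finsupp.prod_fintype, h1, hb]
      · simp
    ext j
    fin_cases j
    · simpa using eq_zero_of_pow_eq_zero hx0
    · simpa using h1
  · rw [Polynomial.eval_homogenize le_rfl x h1] at hx
    exact absurd hx (mul_ne_zero (hroot _) (pow_ne_zero _ h1))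

theorem exists_hasAnisotropicForm_two_pow (hK : ¬ IsAlgClosed K) (j : ℕ) :
    ∃ D, 1 ≤ D ∧ HasAnisotropicForm K (2 ^ j) D := by
  induction j with
  | zero =>
    refine ⟨1, le_rfl, ?_⟩
    rw [pow_zero]
    refine ⟨X 0, isHomogeneous_X _ _, fun x hx => ?_⟩
    ext j
    rw [eval_X] at hx
    rw [Subsingleton.elim j 0, hx, Pi.zero_apply]
  | succ j ih =>
    obtain ⟨D, hD, hform⟩ := ih
    obtain ⟨E, hE, g, hg, hgz⟩ := exists_hasAnisotropicForm_two hK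
    refine ⟨E * D, Nat.mul_pos hE hD, ?_⟩
    have := hform.comp (fun _ : Fin 1 => g) (fun _ => hg) (fun x hx => hgz x (hx 0))
      (q := 2 ^ j) (by simp)
    simpa [pow_succ, mul_comm] using this

theorem IsCField.exists_zero {i : ℕ} (hK : IsCField i K) {σ : Type*} [Fintype σ] {m : ℕ}
    (hm : 1 ≤ m) (hcard : m ^ i < Fintype.card σ) (f : MvPolynomial σ K)
    (hf : f.IsHomogeneous m) : ∃ x : σ → K, x ≠ 0 ∧ eval x f = 0 := by
  by_contra! hcon
  obtain ⟨n, hn⟩ : ∃ n, Fintype.card σ = n + 1 := ⟨Fintype.card σ - 1, by omega⟩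
  have hform := HasAnisotropicForm.of_fintype f hf
    fun x hx => by_contra fun hne => hcon x hne hx
  rw [hn] at hform
  obtain ⟨g, hg, hgz⟩ := hform
  obtain ⟨x, hx, hx'⟩ := hK n m hm (by omega) g hg
  exact hx (hgz x hx')

theorem IsCField.le_of_hasAnisotropicForm {i : ℕ} (hK : IsCField i K) {M D : ℕ} (hD : 1 ≤ D)
    (h : HasAnisotropicForm K M D) : M ≤ D ^ i := by
  by_contra! hlt
  obtain ⟨f, hf, hz⟩ := h
  obtain ⟨x, hx, hx'⟩ := hK.exists_zero hD (by simpa using hlt) f hf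
  exact hx (hz x hx')

theorem IsCField.exists_common_zero_of_not_isAlgClosed {i : ℕ} (hK : IsCField i K)
    (hcl : ¬ IsAlgClosed K) {ι σ : Type*} [Fintype ι] [Fintype σ] [Nonempty ι] {m : ℕ} (hm : 1 ≤ m)
    (hcard : Fintype.card ι * m ^ i < Fintype.card σ) (f : ι → MvPolynomial σ K)
    (hf : ∀ p, (f p).IsHomogeneous m) : ∃ x : σ → K, x ≠ 0 ∧ ∀ p, eval x (f p) = 0 := by
  by_contra! hcon
  have hz : ∀ x, (∀ p, eval x (f p) = 0) → x = 0 := fun x hx => by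
    by_contra hne
    obtain ⟨p, hp⟩ := hcon x hne
    exact hp (hx p)
  set r := Fintype.card ι with hr
  have hr0 : 0 < r := Fintype.card_pos
  set N := Fintype.card σ with hN
  obtain ⟨D, hD, hform⟩ := exists_hasAnisotropicForm_two_pow hcl (r * r)
  have hlarge : r * r ≤ 2 ^ (r * r) := Nat.lt_two_pow_self.le
  have grow : ∀ t : ℕ, ∃ q, r ≤ q ∧ (2 * r * m ^ i + 1) ^ t ≤ (2 * r) ^ t * q ∧
      HasAnisotropicForm K (r * q) (m ^ t * D) := by
    intro t
    induction t with
    | zero =>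
      refine ⟨r, le_rfl, by simpa using Nat.succ_le_of_lt hr0, ?_⟩
      obtain ⟨g, hg, hgz⟩ := hform.exists_fintype (σ := Fin (r * r)) (by simpa using hlarge)
      exact ⟨g, by simpa using hg, hgz⟩
    | succ t ih =>
      obtain ⟨q, hrq, hq, hq'⟩ := ih
      have hcomp := hq'.comp f hf hz (q := q) le_rfl
      have hmi : 1 ≤ m ^ i := Nat.one_le_pow _ _ hm
      have hle : r * (m ^ i * q + q / r) ≤ N * q := by
        have h1 : r * (q / r) ≤ q := Nat.mul_div_le q r
        have h2 : (r * m ^ i + 1) * q ≤ N * q := Nat.mul_le_mul_right q hcard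
        calc r * (m ^ i * q + q / r) = r * m ^ i * q + r * (q / r) := by ring
          _ ≤ r * m ^ i * q + q := by omega
          _ = (r * m ^ i + 1) * q := by ring
          _ ≤ N * q := h2
      refine ⟨m ^ i * q + q / r, ?_, ?_, ?_⟩
      · exact hrq.trans ((Nat.le_mul_of_pos_left q hmi).trans (Nat.le_add_right _ _))
      · have h3 : q ≤ 2 * r * (q / r) := by
          have h4 : 1 ≤ q / r := (Nat.one_le_div_iff hr0).mpr hrq
          have h5 := Nat.div_add_mod q r
          have h6 := Nat.mod_lt q hr0
          nlinarith
        calc (2 * r * m ^ i + 1) ^ (t + 1)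
            = (2 * r * m ^ i + 1) ^ t * (2 * r * m ^ i + 1) := pow_succ _ _
          _ ≤ (2 * r) ^ t * q * (2 * r * m ^ i + 1) := Nat.mul_le_mul_right _ hq
          _ = (2 * r) ^ t * (2 * r * m ^ i * q + q) := by ring
          _ ≤ (2 * r) ^ t * (2 * r * m ^ i * q + 2 * r * (q / r)) := by gcongr
          _ = (2 * r) ^ (t + 1) * (m ^ i * q + q / r) := by ring
      · obtain ⟨g, hg, hgz⟩ := hcomp.exists_fintype (σ := Fin (r * (m ^ i * q + q / r)))
          (by simpa using hle)
        exact ⟨g, by convert hg using 1; ring, hgz⟩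
  have bound : ∀ t : ℕ, (2 * r * m ^ i + 1) ^ t ≤ (2 * r * m ^ i) ^ t * D ^ i := by
    intro t
    obtain ⟨q, -, hq, hq'⟩ := grow t
    have h1 := hK.le_of_hasAnisotropicForm (Nat.mul_pos (pow_pos hm t) hD) hq'
    have h2 : q ≤ (m ^ t * D) ^ i := (Nat.le_mul_of_pos_left q hr0).trans h1
    calc _ ≤ (2 * r) ^ t * q := hq
      _ ≤ (2 * r) ^ t * (m ^ t * D) ^ i := Nat.mul_le_mul_left _ h2
      _ = (2 * r * m ^ i) ^ t * D ^ i := by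
        rw [mul_pow (m ^ t), mul_pow (2 * r), ← pow_mul, ← pow_mul, mul_comm t i, mul_assoc]
  set a := 2 * r * m ^ i with ha
  have ha0 : 0 < a := by positivity
  -- Bernoulli's inequality makes the ratio of the two sides unbounded.
  have hb := bound (a * D ^ i)
  have hbern : ∀ t : ℕ, a ^ t * (a + t) ≤ a * (a + 1) ^ t := by
    intro t
    induction t with
    | zero => simp
    | succ t ih =>
      calc a ^ (t + 1) * (a + (t + 1)) = a ^ t * (a * (a + (t + 1))) := by ring
        _ ≤ a ^ t * ((a + t) * (a + 1)) := Nat.mul_le_mul_left _ (by nlinarith)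
        _ = a ^ t * (a + t) * (a + 1) := by ring
        _ ≤ a * (a + 1) ^ t * (a + 1) := Nat.mul_le_mul_right _ ih
        _ = a * (a + 1) ^ (t + 1) := by ring
  have h1 := (hbern (a * D ^ i)).trans (Nat.mul_le_mul_left a hb)
  have h2 : a ^ (a * D ^ i) * (a + a * D ^ i) ≤ a ^ (a * D ^ i) * (a * D ^ i) := by
    linarith
  have h3 := Nat.le_of_mul_le_mul_left h2 (by positivity)
  omega

/-- A system of forms of degree `m` over a `C_i` field has a common nontrivial zero as soon as
the number of variables exceeds `m ^ i` times the number of forms. -/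
theorem IsCField.exists_common_zero {i : ℕ} (hK : IsCField i K)
    {ι σ : Type*} [Fintype ι] [Fintype σ] {m : ℕ} (hm : 1 ≤ m)
    (hcard : Fintype.card ι * m ^ i < Fintype.card σ) (f : ι → MvPolynomial σ K)
    (hf : ∀ p, (f p).IsHomogeneous m) : ∃ x : σ → K, x ≠ 0 ∧ ∀ p, eval x (f p) = 0 := by
  by_cases hcl : IsAlgClosed K
  · refine IsAlgClosed.exists_common_zero f (fun p => ?_)
      ((Nat.le_mul_of_pos_right _ (pow_pos hm i)).trans_lt hcard)
    rw [eval_zero, constantCoeff_eq]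
    exact (hf p).coeff_eq_zero (by simpa using (Nat.one_le_iff_ne_zero.mp hm).symm)
  · cases isEmpty_or_nonempty ι
    · have : Nonempty σ := Fintype.card_pos_iff.mp (by omega)
      exact ⟨1, one_ne_zero, isEmptyElim⟩
    · exact hK.exists_common_zero_of_not_isAlgClosed hcl hm hcard f hf

end Anisotropic

section Descent

/-- Apply a linear map to the coefficients of a multivariate polynomial. -/
noncomputable def mapCoeffLinear {K R τ : Type*} [CommSemiring K] [CommSemiring R] [Algebra K R]
    (l : R →ₗ[K] K) (F : MvPolynomial τ R) : MvPolynomial τ K :=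
  ∑ d ∈ F.support, monomial d (l (F.coeff d))

theorem isHomogeneous_mapCoeffLinear {K R τ : Type*} [CommSemiring K] [CommSemiring R]
    [Algebra K R] (l : R →ₗ[K] K) {F : MvPolynomial τ R} {m : ℕ} (hF : F.IsHomogeneous m) :
    (mapCoeffLinear l F).IsHomogeneous m :=
  IsHomogeneous.sum _ _ _ fun _ hd =>
    isHomogeneous_monomial _ (hF.degree_eq_sum_deg_support hd).symm

theorem eval_mapCoeffLinear {K R τ : Type*} [CommSemiring K] [CommSemiring R] [Algebra K R]
    (l : R →ₗ[K] K) (F : MvPolynomial τ R) (y : τ → K) :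
    eval y (mapCoeffLinear l F) = l (eval (fun j => algebraMap K R (y j)) F) := by
  rw [mapCoeffLinear, map_sum, eval_eq, map_sum]
  refine Finset.sum_congr rfl fun d _ => ?_
  simp only [← map_pow, ← map_prod]
  rw [mul_comm, ← Algebra.smul_def, map_smul, eval_monomial, smul_eq_mul, mul_comm]
  rfl

variable {K : Type*} [Field K] {i : ℕ}

/-- Zeros of a form over a `K`-algebra `R` can be searched for in the span of a finite linearly
independent family `b`, provided finitely many linear functionals detect the vanishing of its
values there. -/
theorem IsCField.exists_zero_of_functionals (hK : IsCField i K) {R : Type*} [CommRing R]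
    [Algebra K R] {ι κ σ : Type*} [Fintype ι] [Fintype κ] [Fintype σ] {b : ι → R}
    (hb : LinearIndependent K b) (l : κ → R →ₗ[K] K) {m : ℕ} (hm : 1 ≤ m)
    (hcard : Fintype.card κ * m ^ i < Fintype.card σ * Fintype.card ι) (f : MvPolynomial σ R)
    (hf : f.IsHomogeneous m)
    (hl : ∀ x : σ → R, (∀ j, x j ∈ Submodule.span K (Set.range b)) →
      (∀ p, l p (eval x f) = 0) → eval x f = 0) :
    ∃ x : σ → R, x ≠ 0 ∧ eval x f = 0 := by
  let g : σ → MvPolynomial (σ × ι) R := fun j => ∑ a, C (b a) * X (j, a)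
  have hg : ∀ j, (g j).IsHomogeneous 1 := fun j =>
    IsHomogeneous.sum _ _ _ fun a _ => isHomogeneous_C_mul_X _ _
  have hF : (bind₁ g f).IsHomogeneous m := by simpa using hf.aeval g hg
  obtain ⟨y, hy, hyz⟩ := hK.exists_common_zero hm (by simpa using hcard)
    (fun p => mapCoeffLinear (l p) (bind₁ g f)) (fun p => isHomogeneous_mapCoeffLinear _ hF)
  let x : σ → R := fun j => ∑ a, y (j, a) • b a
  have hx : eval (fun j => algebraMap K R (y j)) (bind₁ g f) = eval x f := by
    refine (eval₂Hom_bind₁ (RingHom.id R) _ g f).trans ?_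
    congr 2
    ext j
    simp [g, x, Algebra.smul_def, mul_comm]
  refine ⟨x, fun hx0 => hy ?_, hl x (fun j => ?_) fun p => ?_⟩
  · ext ⟨j, a⟩
    exact Fintype.linearIndependent_iff.mp hb (fun a => y (j, a)) (congrFun hx0 j) a
  · exact Submodule.sum_mem _ fun a _ =>
      Submodule.smul_mem _ _ (Submodule.subset_span ⟨a, rfl⟩)
  · rw [← hx, ← eval_mapCoeffLinear]
    exact hyz p

theorem IsCField.of_finiteDimensional (hK : IsCField i K) (E : Type*) [Field E] [Algebra K E]
    [FiniteDimensional K E] : IsCField i E := by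
  intro n m hm hn f hf
  have b := Module.finBasis K E
  refine hK.exists_zero_of_functionals b.linearIndependent b.coord hm ?_ f hf
    fun x _ hx => b.ext_elem fun p => by simpa using hx p
  have hpos : 0 < Module.finrank K E := Module.finrank_pos
  simp only [Fintype.card_fin]
  rw [mul_comm]
  exact Nat.mul_lt_mul_of_pos_right (by omega) hpos

theorem IsCField.of_isAlgebraic (hK : IsCField i K) (L : Type*) [Field L] [Algebra K L]
    [Algebra.IsAlgebraic K L] : IsCField i L := by
  intro n m hm hn f hf
  let E := IntermediateField.adjoin K (f.coeffs : Set L)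
  have : FiniteDimensional K E :=
    IntermediateField.finiteDimensional_adjoin fun x _ => Algebra.IsIntegral.isIntegral x
  obtain ⟨g, hg⟩ : f ∈ Set.range (map (algebraMap E L)) := by
    rw [mem_range_map_iff_coeffs_subset]
    intro c hc
    exact ⟨⟨c, IntermediateField.subset_adjoin K _ hc⟩, rfl⟩
  have hinj : Function.Injective (algebraMap E L) := (algebraMap E L).injective
  obtain ⟨x, hx, hxz⟩ := hK.of_finiteDimensional E n m hm hn g
    (IsHomogeneous.of_map hinj (hg ▸ hf))
  refine ⟨fun j => algebraMap E L (x j), fun h => hx ?_, ?_⟩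
  · ext1 j
    exact hinj (by simpa using congrFun h j)
  · have h := eval₂_comp (algebraMap E L) x g
    rw [hxz, map_zero] at h
    rw [← hg, eval_map]
    exact h.symm

theorem IsCField.exists_zero_polynomial (hK : IsCField i K) {σ : Type*} [Fintype σ] {m : ℕ}
    (hm : 1 ≤ m) (hcard : m ^ (i + 1) < Fintype.card σ) (f : MvPolynomial σ (Polynomial K))
    (hf : f.IsHomogeneous m) : ∃ x : σ → Polynomial K, x ≠ 0 ∧ eval x f = 0 := by
  let c := f.support.sup fun d => (f.coeff d).natDegree
  let s := (c + 1) * m ^ i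
  have hb : LinearIndependent K fun a : Fin (s + 1) => (Polynomial.X ^ (a : ℕ) : Polynomial K) := by
    have := (Polynomial.basisMonomials K).linearIndependent.comp
      (fun a : Fin (s + 1) => (a : ℕ)) Fin.val_injective
    simpa [Function.comp_def, Polynomial.X_pow_eq_monomial] using this
  refine hK.exists_zero_of_functionals hb
    (fun p : Fin (c + m * s + 1) => Polynomial.lcoeff K p) hm ?_ f hf fun x hx hz => ?_
  · simp only [Fintype.card_fin]
    calc (c + m * s + 1) * m ^ i = s + m ^ (i + 1) * s := by simp only [s]; ring
      _ < (m ^ (i + 1) + 1) * (s + 1) := by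
        have : 0 < m ^ (i + 1) := pow_pos hm _
        nlinarith
      _ ≤ Fintype.card σ * (s + 1) := Nat.mul_le_mul_right _ hcard
  · have hxdeg : ∀ j, (x j).natDegree ≤ s := by
      intro j
      have hle : Submodule.span K (Set.range fun a : Fin (s + 1) =>
          (Polynomial.X ^ (a : ℕ) : Polynomial K)) ≤ Polynomial.degreeLE K s := by
        rw [Submodule.span_le]
        rintro _ ⟨a, rfl⟩
        rw [SetLike.mem_coe, Polynomial.mem_degreeLE]
        exact (Polynomial.degree_X_pow_le _).trans (by exact_mod_cast Nat.lt_succ_iff.mp a.2)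
      exact Polynomial.natDegree_le_of_degree_le (Polynomial.mem_degreeLE.mp (hle (hx j)))
    have hdeg : (eval x f).natDegree ≤ c + m * s := by
      rw [eval_eq']
      refine Polynomial.natDegree_sum_le_of_forall_le _ _ fun d hd => ?_
      refine Polynomial.natDegree_mul_le.trans (add_le_add ?_ ?_)
      · exact Finset.le_sup (f := fun d => (f.coeff d).natDegree) hd
      · refine (Polynomial.natDegree_prod_le _ _).trans ?_
        calc ∑ j, (x j ^ d j).natDegree ≤ ∑ j, d j * s := Finset.sum_le_sum fun j _ =>
              Polynomial.natDegree_pow_le.trans (Nat.mul_le_mul_left _ (hxdeg j))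
          _ = m * s := by
            rw [← Finset.sum_mul, ← Finsupp.degree_eq_sum, hf.degree_eq_sum_deg_support hd]
            rfl
    ext p
    by_cases hp : p < c + m * s + 1
    · exact hz ⟨p, hp⟩
    · exact Polynomial.coeff_eq_zero_of_natDegree_lt (by omega)

theorem IsCField.of_isFractionRing_polynomial (hK : IsCField i K) (L : Type*) [Field L]
    [Algebra (Polynomial K) L] [IsFractionRing (Polynomial K) L] : IsCField (i + 1) L := by
  intro n m hm hn f hf
  obtain ⟨b, hb⟩ := IsLocalization.exist_integer_multiples_of_finset
    (nonZeroDivisors (Polynomial K)) f.coeffs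
  have hinj : Function.Injective (algebraMap (Polynomial K) L) := IsFractionRing.injective _ _
  have hb0 : algebraMap (Polynomial K) L b ≠ 0 :=
    (map_ne_zero_iff _ hinj).mpr (nonZeroDivisors.coe_ne_zero b)
  obtain ⟨g, hg⟩ : C (algebraMap (Polynomial K) L b) * f ∈
      Set.range (map (algebraMap (Polynomial K) L)) := by
    rw [mem_range_map_iff_coeffs_subset]
    intro c hc
    obtain ⟨d, hd, rfl⟩ := mem_coeffs_iff.mp hc
    rw [mem_support_iff, coeff_C_mul] at hd
    obtain ⟨e, he⟩ := hb _ (coeff_mem_coeffs d (right_ne_zero_of_mul hd))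
    exact ⟨e, by rw [he, coeff_C_mul, Algebra.smul_def]⟩
  obtain ⟨x, hx, hxz⟩ := hK.exists_zero_polynomial hm (by simpa using Nat.lt_succ_of_le hn) g
    (IsHomogeneous.of_map hinj (hg ▸ hf.C_mul _))
  refine ⟨fun j => algebraMap (Polynomial K) L (x j), fun h => hx ?_, ?_⟩
  · ext1 j
    exact hinj (by simpa using congrFun h j)
  · have h := eval₂_comp (algebraMap (Polynomial K) L) x g
    rw [hxz, map_zero] at h
    have h' := congrArg (eval fun j => algebraMap (Polynomial K) L (x j)) hg
    rw [eval_map, map_mul, eval_C] at h'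
    exact (mul_eq_zero.mp (h'.symm.trans h.symm)).resolve_left hb0

theorem IsCField.of_ringEquiv {L : Type*} [Field L] (hK : IsCField i K) (e : K ≃+* L) :
    IsCField i L := by
  algebraize [(e : K →+* L)]
  have : Algebra.IsAlgebraic K L :=
    ⟨fun x => e.apply_symm_apply x ▸ isAlgebraic_algebraMap (R := K) (A := L) (e.symm x)⟩
  exact hK.of_isAlgebraic L

theorem IsCField.adjoin_simple {L : Type*} [Field L] [Algebra K L] (hK : IsCField i K) {t : L}
    (ht : Transcendental K t) : IsCField (i + 1) (IntermediateField.adjoin K {t}) :=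
  (hK.of_isFractionRing_polynomial (RatFunc K)).of_ringEquiv
    (RatFunc.algEquivOfTranscendental t ht).toRingEquiv

end Descent

theorem IsTranscendenceBasis.tail_adjoin {k L : Type*} [Field k] [Field L] [Algebra k L] {d : ℕ}
    {x : Fin (d + 1) → L} (hx : IsTranscendenceBasis k x) :
    IsTranscendenceBasis (IntermediateField.adjoin k {x 0}) (fun j : Fin d => x j.succ) := by
  rw [IntermediateField.isTranscendenceBasis_adjoin_iff]
  have hind : AlgebraicIndependent k
      (Sum.elim (fun j : Fin d => x j.succ) (fun _ : Unit => x 0)) := by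
    have h := hx.1.comp (Sum.elim Fin.succ (fun _ : Unit => 0)) (by
      rintro (a | a) (b | b) h <;> simp_all [Fin.succ_ne_zero, eq_comm])
    convert h using 1
    ext (a | a) <;> rfl
  rw [AlgebraicIndependent.sumElim_iff, Set.range_const] at hind
  rw [isTranscendenceBasis_iff_algebraicIndependent_isAlgebraic]
  refine ⟨hind.2, ?_⟩
  have halg := hx.isAlgebraic
  have hrange : Set.range x ⊆ {x 0} ∪ Set.range fun j : Fin d => x j.succ := by
    rintro _ ⟨j, rfl⟩
    obtain rfl | ⟨j, rfl⟩ := Fin.eq_zero_or_eq_succ j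
    · exact Or.inl rfl
    · exact Or.inr ⟨j, rfl⟩
  have hle : Algebra.adjoin k (Set.range x) ≤
      (Algebra.adjoin (Algebra.adjoin k {x 0})
        (Set.range fun j : Fin d => x j.succ)).restrictScalars k := by
    rw [← Algebra.adjoin_union_eq_adjoin_adjoin]
    exact Algebra.adjoin_mono hrange
  exact ⟨fun a => (halg.isAlgebraic a).tower_top_of_subalgebra_le hle⟩

theorem IsCField.of_isTranscendenceBasis {k L : Type u} [Field k] [Field L] [Algebra k L] {i d : ℕ}
    {x : Fin d → L} (hx : IsTranscendenceBasis k x) (hk : IsCField i k) : IsCField (i + d) L := by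
  induction d generalizing k i with
  | zero =>
    have := hx.isEmpty_iff_isAlgebraic.mp inferInstance
    exact hk.of_isAlgebraic L
  | succ d ih =>
    have := ih hx.tail_adjoin (hk.adjoin_simple (hx.1.transcendental 0))
    rwa [Nat.add_right_comm, Nat.add_assoc] at this

/-- **Tsen–Lang–Nagata transition theorem**. If `k'/k` is a field extension of
transcendence degree `d` (witnessed by a transcendence basis indexed by `Fin d`) and `k`
is a `C_i` field, then `k'` is a `C_{i+d}` field. -/
theorem tsen_lang_nagata (k k' : Type*) [Field k] [Field k'] [Algebra k k']
    (i d : ℕ) (x : Fin d → k') (hx : IsTranscendenceBasis k x)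
    (hk : IsCField i k) : IsCField (i + d) k' := by
  cases d with
  | zero =>
    have := hx.isEmpty_iff_isAlgebraic.mp inferInstance
    exact hk.of_isAlgebraic k'
  | succ d =>
    have := (hk.adjoin_simple (hx.1.transcendental 0)).of_isTranscendenceBasis hx.tail_adjoin
    rwa [Nat.add_right_comm, Nat.add_assoc] at this
end

section
/- Let p be a prime number and let K be a p-adic field, i.e. a field which is a finite-dimensional extension of the field ℚ_p of p-adic numbers. Then for every natural number i, K is not a C_i field: there exist natural numbers n and d with d ≥ 1 and d^i ≤ n, and a homogeneous polynomial f of degree d in n+1 variables with coefficients in K, such that the only solution of f(x) = 0 in K^{n+1} is x = 0. -/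
open Polynomial in
/-- Some integer combination of `X, X ^ p, …, X ^ p ^ t` is constant modulo `(X - 1) ^ (t + 1)`,
with a constant that is prime to `p`. -/
theorem exists_sum_X_pow_prime_pow_eq_const_add (p : ℕ) (t : ℕ) :
    ∃ (a : ℕ → ℤ) (c : ℤ) (R : ℤ[X]), IsCoprime (p : ℤ) c ∧
      ∑ j ∈ Finset.range (t + 1), C (a j) * X ^ p ^ j = C c + (X - 1) ^ (t + 1) * R := by
  induction t with
  | zero => exact ⟨fun _ => 1, 1, 1, isCoprime_one_right, by simp⟩
  | succ t ih =>
    obtain ⟨a, c, R, hc, h⟩ := ih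
    have hroot : ((∑ i ∈ Finset.range p, X ^ i) ^ (t + 1) * R.comp (X ^ p)
        - C ((p : ℤ) ^ (t + 1)) * R).IsRoot 1 := by
      simp [IsRoot, eval_finsetSum, eval_comp]
    obtain ⟨S, hS⟩ := dvd_iff_isRoot.mpr hroot
    refine ⟨fun j => (if j = 0 then 0 else a (j - 1)) -
        (if j = t + 1 then 0 else (p : ℤ) ^ (t + 1) * a j),
      (1 - (p : ℤ) ^ (t + 1)) * c, S, ?_, ?_⟩
    · exact IsCoprime.mul_right ⟨(p : ℤ) ^ t, 1, by ring⟩ hc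
    · have hcomp := congrArg (fun P : ℤ[X] => P.comp (X ^ p)) h
      simp only [Polynomial.sum_comp, mul_comp, C_comp, add_comp, pow_comp, sub_comp,
        X_comp, one_comp, ← pow_mul, ← pow_succ'] at hcomp
      have hgeom : (X : ℤ[X]) ^ p - 1 = (∑ i ∈ Finset.range p, X ^ i) * (X - 1) :=
        (geom_sum_mul X p).symm
      have hsplit : ∑ j ∈ Finset.range (t + 1 + 1), C ((if j = 0 then 0 else a (j - 1)) -
          (if j = t + 1 then 0 else (p : ℤ) ^ (t + 1) * a j)) * (X : ℤ[X]) ^ p ^ j =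
          ∑ j ∈ Finset.range (t + 1), C (a j) * X ^ p ^ (j + 1) -
          C ((p : ℤ) ^ (t + 1)) * ∑ j ∈ Finset.range (t + 1), C (a j) * X ^ p ^ j := by
        simp only [C_sub, sub_mul, Finset.sum_sub_distrib]
        congr 1
        · rw [Finset.sum_range_succ']
          simp
        · rw [Finset.sum_range_succ, Finset.mul_sum]
          simp only [if_true, C_0, zero_mul, add_zero]
          refine Finset.sum_congr rfl fun j hj => ?_
          rw [if_neg (Finset.mem_range.mp hj).ne, C_mul, mul_assoc]
      rw [hsplit, hcomp, h, hgeom, mul_pow]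
      simp only [C_1] at hS
      simp only [C_mul, C_sub, C_1]
      linear_combination (X - 1) ^ (t + 1) * hS

section Ultrametric

variable {K : Type*} [NormedField K] [IsUltrametricDist K]

theorem norm_aeval_intPolynomial_le_one {x : K} (hx : ‖x‖ ≤ 1) (R : Polynomial ℤ) :
    ‖Polynomial.aeval x R‖ ≤ 1 := by
  rw [Polynomial.aeval_eq_sum_range]
  refine IsUltrametricDist.norm_sum_le_of_forall_le_of_nonneg zero_le_one fun i _ => ?_
  rw [zsmul_eq_mul, norm_mul, norm_pow]
  exact mul_le_one₀ (IsUltrametricDist.norm_intCast_le_one K _) (by positivity)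
    (pow_le_one₀ (norm_nonneg _) hx)

theorem norm_pow_sub_one_le {u : K} (hu : ‖u‖ ≤ 1) (n : ℕ) : ‖u ^ n - 1‖ ≤ ‖u - 1‖ := by
  rw [← geom_sum_mul, norm_mul]
  refine mul_le_of_le_one_left (norm_nonneg _) ?_
  refine IsUltrametricDist.norm_sum_le_of_forall_le_of_nonneg zero_le_one fun i _ => ?_
  rw [norm_pow]
  exact pow_le_one₀ (norm_nonneg _) hu

theorem norm_pow_prime_pow_sub_one_le {p : ℕ} {u : K} (hu : ‖u‖ ≤ 1)
    (h : ‖u - 1‖ ≤ ‖(p : K)‖) (s : ℕ) : ‖u ^ p ^ s - 1‖ ≤ ‖(p : K)‖ ^ (s + 1) := by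
  induction s with
  | zero => simpa using h
  | succ s ih =>
    set v := u ^ p ^ s with hv
    have hv1 : ‖v‖ ≤ 1 := by rw [hv, norm_pow]; exact pow_le_one₀ (norm_nonneg _) hu
    have hvp : ‖v - 1‖ ≤ ‖(p : K)‖ := (norm_pow_sub_one_le hu _).trans h
    have hsum : ∑ i ∈ Finset.range p, v ^ i = ∑ i ∈ Finset.range p, (v ^ i - 1) + (p : K) := by
      simp
    rw [pow_succ, pow_mul, ← hv, ← geom_sum_mul, norm_mul, pow_succ' _ (s + 1), hsum]
    gcongr
    refine (IsUltrametricDist.norm_add_le_max _ _).trans (max_le ?_ le_rfl)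
    exact IsUltrametricDist.norm_sum_le_of_forall_le_of_nonneg (norm_nonneg _)
      fun i _ => (norm_pow_sub_one_le hv1 i).trans hvp

theorem norm_intCast_eq_one_of_isCoprime {p c : ℤ} (hp : ‖(p : K)‖ < 1) (h : IsCoprime p c) :
    ‖(c : K)‖ = 1 := by
  refine le_antisymm (IsUltrametricDist.norm_intCast_le_one K c) (not_lt.mp fun hc => ?_)
  obtain ⟨a, b, hab⟩ := h
  have hK : (a : K) * p + b * c = 1 := mod_cast congrArg (Int.cast : ℤ → K) hab
  have hlt : ‖(a : K) * p + b * c‖ < 1 := by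
    refine (IsUltrametricDist.norm_add_le_max _ _).trans_lt (max_lt ?_ ?_) <;> rw [norm_mul]
    · exact (mul_le_of_le_one_left (norm_nonneg _)
        (IsUltrametricDist.norm_intCast_le_one K _)).trans_lt hp
    · exact (mul_le_of_le_one_left (norm_nonneg _)
        (IsUltrametricDist.norm_intCast_le_one K _)).trans_lt hc
  rw [hK, norm_one] at hlt
  exact lt_irrefl _ hlt

theorem prime_pow_dvd_of_norm_natCast_le {p : ℕ} (hp : p.Prime) (hp0 : (p : K) ≠ 0)
    (hp1 : ‖(p : K)‖ < 1) {m M : ℕ} (h : ‖(m : K)‖ ≤ ‖(p : K)‖ ^ M) : p ^ M ∣ m := by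
  rcases eq_or_ne m 0 with rfl | hm
  · exact dvd_zero _
  obtain ⟨v, m', hm', rfl⟩ := Nat.exists_eq_pow_mul_and_not_dvd hm p hp.ne_one
  have hcop : IsCoprime (p : ℤ) (m' : ℤ) :=
    Nat.isCoprime_iff_coprime.mpr ((Nat.Prime.coprime_iff_not_dvd hp).mpr hm')
  have h1 := norm_intCast_eq_one_of_isCoprime (K := K) (by simpa using hp1) hcop
  rw [Int.cast_natCast] at h1
  rw [Nat.cast_mul, norm_mul, h1, mul_one, Nat.cast_pow, norm_pow] at h
  exact Dvd.dvd.mul_right (pow_dvd_pow p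
    ((pow_le_pow_iff_right_of_lt_one₀ (norm_pos_iff.mpr hp0) hp1).mp h)) _

theorem exists_pow_near_zero_or_one [ProperSpace K] {r : ℝ} (hr : 0 < r) :
    ∃ N : ℕ, 0 < N ∧ ∀ x : K, ‖x‖ ≤ 1 → ‖x ^ N‖ ≤ r ∨ ‖x ^ N - 1‖ ≤ r := by
  obtain ⟨T, -, hTfin, hT⟩ := (isCompact_closedBall (0 : K) 1).finite_cover_balls hr
  lift T to Finset K using hTfin
  refine ⟨T.card.factorial, Nat.factorial_pos _, fun x hx => ?_⟩
  have hcover : ∀ n : ℕ, ∃ c ∈ T, x ^ n ∈ Metric.ball c r := fun n => by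
    have hmem : x ^ n ∈ Metric.closedBall (0 : K) 1 := by
      rw [mem_closedBall_zero_iff, norm_pow]
      exact pow_le_one₀ (norm_nonneg _) hx
    simpa using hT hmem
  choose c hcT hc using hcover
  obtain ⟨a, ha, b, hb, hab, hcab⟩ := Finset.exists_ne_map_eq_of_card_lt_of_maps_to
    (s := Finset.range (T.card + 1)) (t := T) (f := c) (by simp) (fun n _ => hcT n)
  wlog hlt : a < b generalizing a b
  · exact this b hb a ha hab.symm hcab.symm (lt_of_le_of_ne (not_lt.mp hlt) hab.symm)
  have hbT : b ≤ T.card := Nat.lt_succ_iff.mp (Finset.mem_range.mp hb)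
  have hdist : ‖x ^ a‖ * ‖x ^ (b - a) - 1‖ ≤ r := by
    rw [← norm_mul, mul_sub, ← pow_add, Nat.add_sub_cancel' hlt.le, mul_one, ← dist_eq_norm]
    have hb' := Metric.mem_ball.mp (hc b)
    have ha' := Metric.mem_ball'.mp (hc a)
    rw [← hcab] at hb'
    exact (dist_triangle_max _ _ _).trans (max_le hb'.le ha'.le)
  rcases hx.lt_or_eq with hx1 | hx1
  · left
    have hone : ‖x ^ (b - a) - 1‖ = 1 := by
      have hlt1 : ‖x ^ (b - a)‖ < 1 := by
        rw [norm_pow]; exact pow_lt_one₀ (norm_nonneg _) hx1 (Nat.sub_ne_zero_of_lt hlt)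
      rw [sub_eq_add_neg, IsUltrametricDist.norm_add_eq_max_of_norm_ne_norm (by simpa using hlt1.ne),
        norm_neg, norm_one, max_eq_right hlt1.le]
    rw [hone, mul_one, norm_pow] at hdist
    rw [norm_pow]
    exact (pow_le_pow_of_le_one (norm_nonneg _) hx
      ((hlt.le.trans hbT).trans (Nat.self_le_factorial _))).trans hdist
  · right
    rw [norm_pow, hx1, one_pow, one_mul] at hdist
    obtain ⟨q, hq⟩ := Nat.dvd_factorial (Nat.sub_pos_of_lt hlt) ((Nat.sub_le b a).trans hbT)
    rw [hq, pow_mul]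
    exact (norm_pow_sub_one_le (by rw [norm_pow, hx1, one_pow]) q).trans hdist

theorem exists_maximal_norm_lt_one [ProperSpace K] {ϖ : K} (h0 : ϖ ≠ 0) (h1 : ‖ϖ‖ < 1) :
    ∃ π : K, π ≠ 0 ∧ ‖π‖ < 1 ∧ ∀ x : K, ‖x‖ < 1 → ‖x‖ ≤ ‖π‖ := by
  have hcomp : IsCompact (Metric.ball (0 : K) 1) :=
    Metric.isCompact_of_isClosed_isBounded (IsUltrametricDist.isClosed_ball 0 1)
      Metric.isBounded_ball
  obtain ⟨π, hπ, hmax⟩ := hcomp.exists_isMaxOn ⟨0, by simp⟩ continuous_norm.continuousOn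
  have hle : ∀ x : K, ‖x‖ < 1 → ‖x‖ ≤ ‖π‖ := fun x hx => hmax (by simpa using hx)
  refine ⟨π, ?_, by simpa using hπ, hle⟩
  exact norm_pos_iff.mp ((norm_pos_iff.mpr h0).trans_le (hle ϖ h1))

theorem eq_zero_of_sum_eq_zero_of_pairwise_norm_ne {ι : Type*} (s : Finset ι) (g : ι → K)
    (hg : ∀ k ∈ s, ∀ l ∈ s, k ≠ l → g k ≠ 0 → ‖g k‖ ≠ ‖g l‖) (h : ∑ k ∈ s, g k = 0) :
    ∀ k ∈ s, g k = 0 := by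
  classical
  by_contra! hne
  obtain ⟨k₀, hk₀, hgk₀⟩ := hne
  obtain ⟨k, hk, hmax⟩ := s.exists_max_image (fun k => ‖g k‖) ⟨k₀, hk₀⟩
  have hpos : 0 < ‖g k‖ := (norm_pos_iff.mpr hgk₀).trans_le (hmax k₀ hk₀)
  rw [← Finset.add_sum_erase s g hk, add_eq_zero_iff_eq_neg] at h
  have hnorm : ‖g k‖ = ‖∑ l ∈ s.erase k, g l‖ := by rw [h, norm_neg]
  rcases (s.erase k).eq_empty_or_nonempty with hs | hs
  · rw [hs, Finset.sum_empty, norm_zero] at hnorm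
    exact hpos.ne' hnorm
  · obtain ⟨l, hl, hle⟩ := IsUltrametricDist.exists_norm_finsetSum_le_of_nonempty hs g
    have hls := Finset.mem_erase.mp hl
    exact hg k hk l hls.2 hls.1.symm (norm_pos_iff.mp hpos)
      (le_antisymm (hnorm.trans_le hle) (hmax l hls.2))

/-- The form `∑ k ≤ t, π ^ k * z k ^ (t + 1)` is anisotropic when `π` is a uniformizer. -/
theorem eq_zero_of_sum_uniformizer_pow_mul_pow_eq_zero {π : K} (hπ0 : π ≠ 0) (hπ1 : ‖π‖ < 1)
    (hπ : ∀ x : K, ‖x‖ < 1 → ‖x‖ ≤ ‖π‖) (t : ℕ) (z : ℕ → K)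
    (h : ∑ k ∈ Finset.range (t + 1), π ^ k * z k ^ (t + 1) = 0) :
    ∀ k ∈ Finset.range (t + 1), z k = 0 := by
  have hpos : 0 < ‖π‖ := norm_pos_iff.mpr hπ0
  have key : ∀ k l : ℕ, k < l → l < t + 1 → z l ≠ 0 →
      ‖π ^ k * z k ^ (t + 1)‖ ≠ ‖π ^ l * z l ^ (t + 1)‖ := by
    intro k l hkl hl hzl heq
    have hzpos : 0 < ‖z l‖ := norm_pos_iff.mpr hzl
    have hw : ‖z k / z l‖ ^ (t + 1) = ‖π‖ ^ (l - k) := by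
      obtain ⟨e, rfl⟩ := Nat.exists_eq_add_of_lt hkl
      simp only [norm_mul, norm_pow] at heq
      rw [norm_div, div_pow, div_eq_iff (by positivity)]
      have hk : ‖π‖ ^ k ≠ 0 := by positivity
      apply mul_left_cancel₀ hk
      rw [heq, ← mul_assoc, ← pow_add]
      congr 2
      omega
    have hlt : ‖z k / z l‖ < 1 := by
      refine lt_of_pow_lt_pow_left₀ (t + 1) zero_le_one ?_
      rw [hw, one_pow]
      exact pow_lt_one₀ hpos.le hπ1 (Nat.sub_ne_zero_of_lt hkl)
    have hle := pow_le_pow_left₀ (norm_nonneg _) (hπ _ hlt) (t + 1)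
    rw [hw, pow_le_pow_iff_right_of_lt_one₀ hpos hπ1] at hle
    omega
  have hall := eq_zero_of_sum_eq_zero_of_pairwise_norm_ne _ _ (fun k hk l hl hkl hgk => ?_) h
  · intro k hk
    simpa [hπ0] using hall k hk
  · have hzk : z k ≠ 0 := by rintro h0; simp [h0] at hgk
    intro heq
    have hzl : z l ≠ 0 := by
      rintro h0
      rw [h0, zero_pow (Nat.succ_ne_zero t), mul_zero, norm_zero, norm_eq_zero] at heq
      exact hgk heq
    rcases lt_or_gt_of_ne hkl with hlt | hlt
    · exact key k l hlt (Finset.mem_range.mp hl) hzl heq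
    · exact key l k hlt (Finset.mem_range.mp hk) hzk heq.symm

/-- Few elements cannot have vanishing power sums of all exponents `N * p ^ (2 * t + j)`, `j ≤ t`,
unless they all vanish. -/
theorem eq_zero_of_power_sums_eq_zero {p : ℕ} (hp : p.Prime) (hp0 : (p : K) ≠ 0)
    (hp1 : ‖(p : K)‖ < 1) {N : ℕ}
    (hN : ∀ x : K, ‖x‖ ≤ 1 → ‖x ^ N‖ ≤ ‖(p : K)‖ ∨ ‖x ^ N - 1‖ ≤ ‖(p : K)‖)
    {ι : Type*} [Fintype ι] (t : ℕ) (hcard : Fintype.card ι < p ^ t ^ 2) (x : ι → K)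
    (h : ∀ j ∈ Finset.range (t + 1), ∑ i, x i ^ (N * p ^ (2 * t + j)) = 0) : x = 0 := by
  classical
  by_contra hx
  obtain ⟨i₁, hi₁⟩ := Function.ne_iff.mp hx
  obtain ⟨i₀, -, hmax⟩ := Finset.univ.exists_max_image (fun i => ‖x i‖) ⟨i₁, Finset.mem_univ _⟩
  have hi₀ : x i₀ ≠ 0 :=
    norm_pos_iff.mp ((norm_pos_iff.mpr hi₁).trans_le (hmax i₁ (Finset.mem_univ _)))
  let w : ι → K := fun i => x i / x i₀
  have hw1 : ∀ i, ‖w i‖ ≤ 1 := fun i => by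
    rw [norm_div]
    exact div_le_one_of_le₀ (hmax i (Finset.mem_univ _)) (norm_nonneg _)
  have hw₀ : w i₀ = 1 := div_self hi₀
  have hw : ∀ j ∈ Finset.range (t + 1), ∑ i, w i ^ (N * p ^ (2 * t + j)) = 0 := fun j hj => by
    simp only [w, div_pow, ← Finset.sum_div, h j hj, zero_div]
  set y : ι → K := fun i => w i ^ (N * p ^ (2 * t)) with hy
  have hy1 : ∀ i, ‖y i‖ ≤ 1 := fun i => by
    rw [hy, norm_pow]; exact pow_le_one₀ (norm_nonneg _) (hw1 i)
  obtain ⟨a, c, R, hc, hP⟩ := exists_sum_X_pow_prime_pow_eq_const_add p t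
  let P : K → K := fun u => ∑ j ∈ Finset.range (t + 1), (a j : K) * u ^ p ^ j
  have hPu : ∀ u : K, P u = c + (u - 1) ^ (t + 1) * Polynomial.aeval u R := fun u => by
    simpa [P] using congrArg (Polynomial.aeval u) hP
  have hsum : ∑ i, P (y i) = 0 := by
    simp only [P]
    rw [Finset.sum_comm]
    refine Finset.sum_eq_zero fun j hj => ?_
    rw [← Finset.mul_sum]
    simp only [hy, ← pow_mul, mul_assoc, ← pow_add]
    rw [hw j hj, mul_zero]
  set r := ‖(p : K)‖ with hr
  have hr0 : 0 ≤ r := norm_nonneg _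
  let U : Finset ι := Finset.univ.filter fun i => ‖w i ^ N - 1‖ ≤ r
  have hterm : ∀ i, ‖P (y i) - if i ∈ U then (c : K) else 0‖ ≤ r ^ t ^ 2 := by
    intro i
    by_cases hi : i ∈ U
    · have hi' : ‖w i ^ N - 1‖ ≤ r := (Finset.mem_filter.mp hi).2
      rw [if_pos hi, hPu, add_sub_cancel_left, norm_mul, norm_pow]
      refine (mul_le_of_le_one_right (by positivity)
        (norm_aeval_intPolynomial_le_one (hy1 i) R)).trans ?_
      have hyi : ‖y i - 1‖ ≤ r ^ (2 * t + 1) := by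
        rw [hy]
        simp only [pow_mul (w i)]
        exact norm_pow_prime_pow_sub_one_le
          (by rw [norm_pow]; exact pow_le_one₀ (norm_nonneg _) (hw1 i)) hi' _
      refine (pow_le_pow_left₀ (norm_nonneg _) hyi _).trans ?_
      rw [← pow_mul]
      exact pow_le_pow_of_le_one hr0 hp1.le (by nlinarith)
    · have hi' : ‖w i ^ N‖ ≤ r := (hN _ (hw1 i)).resolve_right fun h' =>
        hi (Finset.mem_filter.mpr ⟨Finset.mem_univ _, h'⟩)
      rw [if_neg hi, sub_zero]
      have hyi : ‖y i‖ ≤ r ^ t ^ 2 := by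
        rw [hy]
        simp only [pow_mul (w i), norm_pow (w i ^ N)]
        refine (pow_le_pow_left₀ (norm_nonneg _) hi' _).trans
          (pow_le_pow_of_le_one hr0 hp1.le ?_)
        rw [mul_comm 2 t, pow_mul]
        exact Nat.pow_le_pow_left (Nat.lt_pow_self hp.one_lt).le 2
      refine IsUltrametricDist.norm_sum_le_of_forall_le_of_nonneg (by positivity) fun j _ => ?_
      rw [norm_mul, norm_pow]
      refine (mul_le_of_le_one_left (by positivity)
        (IsUltrametricDist.norm_intCast_le_one K _)).trans (le_trans ?_ hyi)
      exact pow_le_of_le_one (norm_nonneg _) (hy1 i) (pow_ne_zero _ hp.ne_zero)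
  have hcU : ‖(U.card : K)‖ ≤ r ^ t ^ 2 := by
    have hle := IsUltrametricDist.norm_sum_le_of_forall_le_of_nonneg (s := Finset.univ)
      (C := r ^ t ^ 2) (by positivity) fun i _ => hterm i
    rw [Finset.sum_sub_distrib, hsum, zero_sub, norm_neg, Finset.sum_ite_mem, Finset.univ_inter,
      Finset.sum_const, nsmul_eq_mul, norm_mul,
      norm_intCast_eq_one_of_isCoprime (by simpa using hp1) hc, mul_one] at hle
    exact hle
  have hdvd := prime_pow_dvd_of_norm_natCast_le hp hp0 hp1 hcU
  have hUpos : 0 < U.card := Finset.card_pos.mpr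
    ⟨i₀, Finset.mem_filter.mpr ⟨Finset.mem_univ _, by simp [hw₀, hr0]⟩⟩
  exact absurd (Nat.le_of_dvd hUpos hdvd) (not_le.mpr ((Finset.card_le_univ U).trans_lt hcard))

theorem exists_anisotropic_form_of_properSpace [ProperSpace K] {p : ℕ} (hp : p.Prime)
    (hp0 : (p : K) ≠ 0) (hp1 : ‖(p : K)‖ < 1) (i : ℕ) :
    ∃ (n d : ℕ), 1 ≤ d ∧ d ^ i ≤ n ∧
      ∃ f : MvPolynomial (Fin (n + 1)) K, f.IsHomogeneous d ∧
        ∀ x : Fin (n + 1) → K, MvPolynomial.eval x f = 0 → x = 0 := by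
  obtain ⟨N, hN0, hN⟩ := exists_pow_near_zero_or_one (K := K) (norm_pos_iff.mpr hp0)
  obtain ⟨π, hπ0, hπ1, hπ⟩ := exists_maximal_norm_lt_one hp0 hp1
  let t := i * (4 + N) + 2
  let d := N * p ^ (3 * t) * (t + 1)
  have hcard : d ^ i + 1 < p ^ t ^ 2 := by
    have hd : d ≤ p ^ (4 * t + N) := by
      calc d ≤ p ^ N * p ^ (3 * t) * p ^ t := by
            exact Nat.mul_le_mul (Nat.mul_le_mul_right _ (Nat.lt_pow_self hp.one_lt).le)
              (Nat.lt_pow_self hp.one_lt)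
        _ = p ^ (4 * t + N) := by rw [← pow_add, ← pow_add]; congr 1; ring
    have hexp : (4 * t + N) * i + 2 ≤ t ^ 2 := by
      have ht : t = i * (4 + N) + 2 := rfl
      nlinarith [Nat.zero_le (i * N), Nat.zero_le (i * N * t)]
    have h2 : 1 ≤ p ^ ((4 * t + N) * i) := Nat.one_le_pow _ _ hp.pos
    calc d ^ i + 1 ≤ p ^ ((4 * t + N) * i) + 1 := by
          rw [pow_mul]; gcongr
      _ < p ^ ((4 * t + N) * i) * p ^ 2 := by
          nlinarith [Nat.pow_le_pow_left hp.two_le 2]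
      _ ≤ p ^ t ^ 2 := by rw [← pow_add]; exact Nat.pow_le_pow_right hp.pos hexp
  let F : ℕ → MvPolynomial (Fin (d ^ i + 1)) K := fun k =>
    ∑ j, MvPolynomial.X j ^ (N * p ^ (2 * t + k))
  refine ⟨d ^ i, d, Nat.mul_pos (Nat.mul_pos hN0 (Nat.pow_pos hp.pos)) t.succ_pos, le_rfl,
    ∑ k ∈ Finset.range (t + 1), MvPolynomial.C (π ^ k) * (F k ^ p ^ (t - k)) ^ (t + 1), ?_, ?_⟩
  · refine MvPolynomial.IsHomogeneous.sum _ _ _ fun k hk => MvPolynomial.IsHomogeneous.C_mul ?_ _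
    have hF : (F k).IsHomogeneous (N * p ^ (2 * t + k)) :=
      MvPolynomial.IsHomogeneous.sum _ _ _ fun j _ => MvPolynomial.isHomogeneous_X_pow _ _
    convert (hF.pow (p ^ (t - k))).pow (t + 1) using 1
    have hkt : k ≤ t := Nat.lt_succ_iff.mp (Finset.mem_range.mp hk)
    rw [mul_assoc N, ← pow_add, show 2 * t + k + (t - k) = 3 * t by omega]
  · intro x hx
    simp only [map_sum, map_mul, map_pow, MvPolynomial.eval_C] at hx
    refine eq_zero_of_power_sums_eq_zero hp hp0 hp1 hN t (by simpa using hcard) x fun k hk => ?_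
    have hFk := eq_zero_of_sum_uniformizer_pow_mul_pow_eq_zero hπ0 hπ1 hπ t
      (fun k => MvPolynomial.eval x (F k) ^ p ^ (t - k)) hx k hk
    simpa [F] using pow_eq_zero_iff (pow_ne_zero _ hp.ne_zero) |>.mp hFk

end Ultrametric

/-- **Arkhipov–Karatsuba / Alemu**. A `p`-adic field `K` (a finite-dimensional field
extension of `ℚ_p`) is not a `C_i` field, for any natural number `i`: there is a
homogeneous polynomial of degree `d ≥ 1` in `n+1` variables with `d ^ i ≤ n` whose only
zero in `K^{n+1}` is the origin. -/
theorem padic_field_not_Ci (p : ℕ) [Fact p.Prime]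
    (K : Type*) [Field K] [Algebra ℚ_[p] K] [FiniteDimensional ℚ_[p] K] (i : ℕ) :
    ∃ (n d : ℕ), 1 ≤ d ∧ d ^ i ≤ n ∧
      ∃ f : MvPolynomial (Fin (n + 1)) K, f.IsHomogeneous d ∧
        ∀ x : Fin (n + 1) → K, MvPolynomial.eval x f = 0 → x = 0 := by
  let : NormedField K := spectralNorm.normedField ℚ_[p] K
  let : NormedAlgebra ℚ_[p] K := spectralNorm.normedAlgebra ℚ_[p] K
  have : IsUltrametricDist K := IsUltrametricDist.of_normedAlgebra ℚ_[p]
  have : ProperSpace K := FiniteDimensional.proper ℚ_[p] K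
  have hp : p.Prime := Fact.out
  have hcast : (p : K) = algebraMap ℚ_[p] K p := (map_natCast _ p).symm
  refine exists_anisotropic_form_of_properSpace hp ?_ ?_ i
  · rw [hcast, Ne, map_eq_zero]
    exact_mod_cast hp.ne_zero
  · rw [hcast, norm_algebraMap']
    exact Padic.norm_p_lt_one
end
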